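/- arXiv:2202.01588 — 2 statements merged into one kernel-verified Lean document; each statement's English description precedes it below -/
import Mathlib

section
/- (Theorem A.4: ordered product expansion of affine type A₁⁽¹⁾, quantum-plane form.) Let e be a positive integer and β, β' integers. In the completed quantum plane A_{2e} (so Y₂Y₁ = v^{4e}·Y₁Y₂), the identity Ψ_{v^e}(v^{β'}·Y₂) · Ψ_{v^e}(v^{β}·Y₁) = (→∏_{p≥0} Ψ_{v^e}(v^{(p+1)β+pβ'}·y^{(p+1,p)})) · (∏_{p≥0} Ψ_{v^{2^p e}}(v^{2^p(β+β')−2^p e}·y^{(2^p,2^p)}) · Ψ_{v^{2^p e}}(v^{2^p(β+β')+2^p e}·y^{(2^p,2^p)})) · (←∏_{p≥0} Ψ_{v^e}(v^{pβ+(p+1)β'}·y^{(p,p+1)})) holds, where all infinite ordered products are coefficientwise limits of partial ordered products (the middle factors pairwise commute). In particular, for e = 1 and β = β' = 0 this is the consistency relation of the rank-2 quantum cluster scattering diagram of affine type A₁⁽¹⁾ with (δ₁,δ₂) = (2,2). -/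
noncomputable section

open Filter

abbrev K : Type := RatFunc ℚ

/-- The indeterminate generator `v` of `K = ℚ(v)`. -/
def v : K := RatFunc.X

/-- The completed quantum plane: formal series `Σ c_{m,n}·Y₁^m Y₂^n`, encoded as
coefficient functions `ℕ × ℕ → K`. -/
abbrev QP : Type := (ℕ × ℕ) → K

/-- The twisted product of the completed quantum plane `A_γ`:
`(Y₁^a Y₂^b)·(Y₁^{a'} Y₂^{b'}) = v^{2γba'}·Y₁^{a+a'} Y₂^{b+b'}`, extended bilinearly and
continuously for the coefficientwise topology. -/
def qmul (γ : ℕ) (F G : QP) : QP := fun p =>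
  ∑ a ∈ Finset.range (p.1 + 1), ∑ b ∈ Finset.range (p.2 + 1),
    v ^ (2 * γ * b * (p.1 - a)) * F (a, b) * G (p.1 - a, p.2 - b)

/-- The multiplicative unit of the completed quantum plane. -/
def qone : QP := fun p => if p = (0, 0) then 1 else 0

/-- Powers in the completed quantum plane. -/
def qpow (γ : ℕ) (Z : QP) : ℕ → QP
  | 0 => qone
  | k + 1 => qmul γ Z (qpow γ Z k)

/-- The element `v^β · y^{(m,n)} = v^{β + γmn} · Y₁^m Y₂^n` of `A_γ`
(`y^{(m,n)} := v^{γmn}·Y₁^m Y₂^n` is the normalized quantum monomial). -/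
def qy (γ : ℕ) (β : ℤ) (m n : ℕ) : QP := fun p =>
  if p = (m, n) then v ^ (β + (γ : ℤ) * (m : ℤ) * (n : ℤ)) else 0

/-- The series `Σ_{j≥1} ((−1)^{j+1}/(j·(w^j − w^{−j})))·Z^j` (for `Z` with zero
constant term, the coefficient at `(m,n)` only involves `j ≤ m + n`). -/
def qarg (γ : ℕ) (w : K) (Z : QP) : QP := fun r =>
  ∑ j ∈ Finset.Icc 1 (r.1 + r.2),
    ((-1 : K) ^ (j + 1) / ((j : K) * (w ^ j - w⁻¹ ^ j))) * qpow γ Z j r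

/-- The quantum dilogarithm `Ψ_w(Z) = exp(Σ_{j≥1} ((−1)^{j+1}/(j(w^j − w^{−j})))·Z^j)`
in `A_γ`, for `Z` with zero constant term. -/
def qPsi (γ : ℕ) (w : K) (Z : QP) : QP := fun p =>
  ∑ k ∈ Finset.range (p.1 + p.2 + 1),
    ((Nat.factorial k : K)⁻¹) * qpow γ (qarg γ w Z) k p

/-- The ordered product `→∏_{p=a..b} g_p = g_a g_{a+1} ⋯ g_b` in `A_γ`. -/
def qprodR (γ : ℕ) (g : ℕ → QP) (a b : ℕ) : QP :=
  ((List.range' a (b + 1 - a)).map g).foldr (qmul γ) qone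

/-- The ordered product `←∏_{p=a..b} g_p = g_b ⋯ g_{a+1} g_a` in `A_γ`. -/
def qprodL (γ : ℕ) (g : ℕ → QP) (a b : ℕ) : QP :=
  ((List.range' a (b + 1 - a)).reverse.map g).foldr (qmul γ) qone

namespace QuantumPlane

open Finset

variable {k : Type*} [Field k]

/-- The completed quantum plane with `Y₂ Y₁ = t • Y₁ Y₂`, as formal series in two variables. -/
def Series {k : Type*} (_t : k) : Type _ := ℕ × ℕ → k

namespace Series

variable {t : k}

instance : AddCommGroup (Series t) := inferInstanceAs (AddCommGroup (ℕ × ℕ → k))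
instance : Module k (Series t) := inferInstanceAs (Module k (ℕ × ℕ → k))

/-- The coefficient of `Y₁ ^ p.1 * Y₂ ^ p.2`. -/
def coeff (p : ℕ × ℕ) : Series t →ₗ[k] k := LinearMap.proj (φ := fun _ : ℕ × ℕ => k) p

@[ext] theorem ext {F G : Series t} (h : ∀ p, coeff p F = coeff p G) : F = G := funext h

/-- The series with prescribed coefficients. -/
def ofCoeff (t : k) (f : ℕ × ℕ → k) : Series t := f

@[simp] theorem coeff_ofCoeff (f : ℕ × ℕ → k) (p : ℕ × ℕ) : coeff p (ofCoeff t f) = f p := rfl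

instance : Mul (Series t) where
  mul F G := ofCoeff t fun p => ∑ a ∈ range (p.1 + 1), ∑ b ∈ range (p.2 + 1),
    t ^ (b * (p.1 - a)) * coeff (a, b) F * coeff (p.1 - a, p.2 - b) G

instance : One (Series t) where
  one := ofCoeff t fun p => if p = (0, 0) then 1 else 0

theorem coeff_one (p : ℕ × ℕ) : coeff p (1 : Series t) = if p = (0, 0) then 1 else 0 := rfl

theorem coeff_mul_range (F G : Series t) (p : ℕ × ℕ) :
    coeff p (F * G) = ∑ a ∈ range (p.1 + 1), ∑ b ∈ range (p.2 + 1),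
      t ^ (b * (p.1 - a)) * coeff (a, b) F * coeff (p.1 - a, p.2 - b) G := rfl

theorem coeff_mul (F G : Series t) (p : ℕ × ℕ) :
    coeff p (F * G) = ∑ x ∈ antidiagonal p.1, ∑ y ∈ antidiagonal p.2,
      t ^ (y.1 * x.2) * coeff (x.1, y.1) F * coeff (x.2, y.2) G := by
  rw [coeff_mul_range, Nat.sum_antidiagonal_eq_sum_range_succ_mk]
  refine sum_congr rfl fun a _ => ?_
  rw [Nat.sum_antidiagonal_eq_sum_range_succ_mk]

theorem sum_antidiagonal_assoc {M : Type*} [AddCommMonoid M] (n : ℕ) (f : ℕ → ℕ → ℕ → M) :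
    ∑ x ∈ antidiagonal n, ∑ y ∈ antidiagonal x.1, f y.1 y.2 x.2 =
      ∑ x ∈ antidiagonal n, ∑ y ∈ antidiagonal x.2, f x.1 y.1 y.2 := by
  rw [sum_sigma', sum_sigma']
  refine sum_nbij' (fun z => ⟨(z.2.1, z.2.2 + z.1.2), (z.2.2, z.1.2)⟩)
    (fun z => ⟨(z.1.1 + z.2.1, z.2.2), (z.1.1, z.2.1)⟩) ?_ ?_ ?_ ?_ ?_
  · simp +contextual [← add_assoc]
  · simp +contextual [add_assoc]
  · rintro ⟨⟨a, b⟩, ⟨c, d⟩⟩ h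
    simp only [mem_sigma, HasAntidiagonal.mem_antidiagonal] at h
    simp [h.2]
  · rintro ⟨⟨a, b⟩, ⟨c, d⟩⟩ h
    simp only [mem_sigma, HasAntidiagonal.mem_antidiagonal] at h
    simp [h.2]
  · simp

protected theorem mul_assoc (F G H : Series t) : F * G * H = F * (G * H) := by
  ext p
  let f : ℕ → ℕ → ℕ → ℕ → ℕ → ℕ → k := fun a b c a' b' c' =>
    t ^ (a' * b + a' * c + b' * c) * coeff (a, a') F * coeff (b, b') G * coeff (c, c') H
  have h₁ : coeff p (F * G * H) = ∑ x ∈ antidiagonal p.1, ∑ x' ∈ antidiagonal x.1,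
      ∑ y ∈ antidiagonal p.2, ∑ y' ∈ antidiagonal y.1, f x'.1 x'.2 x.2 y'.1 y'.2 y.2 := by
    rw [coeff_mul]
    refine sum_congr rfl fun x _ => ?_
    rw [sum_comm]
    refine sum_congr rfl fun y _ => ?_
    rw [coeff_mul, mul_sum, sum_mul]
    refine sum_congr rfl fun x' _ => ?_
    rw [mul_sum, sum_mul]
    refine sum_congr rfl fun y' hy' => ?_
    rw [HasAntidiagonal.mem_antidiagonal] at hy'
    simp only [f, ← hy', pow_add, add_mul]
    ring
  have h₂ : coeff p (F * (G * H)) = ∑ x ∈ antidiagonal p.1, ∑ x' ∈ antidiagonal x.2,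
      ∑ y ∈ antidiagonal p.2, ∑ y' ∈ antidiagonal y.2, f x.1 x'.1 x'.2 y.1 y'.1 y'.2 := by
    rw [coeff_mul]
    refine sum_congr rfl fun x _ => ?_
    rw [sum_comm]
    refine sum_congr rfl fun y _ => ?_
    rw [coeff_mul, mul_sum]
    refine sum_congr rfl fun x' hx' => ?_
    rw [mul_sum]
    refine sum_congr rfl fun y' _ => ?_
    rw [HasAntidiagonal.mem_antidiagonal] at hx'
    simp only [f, ← hx', pow_add, mul_add]
    ring
  rw [h₁, h₂, sum_antidiagonal_assoc p.1 fun a b c =>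
    ∑ y ∈ antidiagonal p.2, ∑ y' ∈ antidiagonal y.1, f a b c y'.1 y'.2 y.2]
  refine sum_congr rfl fun x _ => sum_congr rfl fun x' _ => ?_
  exact sum_antidiagonal_assoc p.2 fun a b c => f x.1 x'.1 x'.2 a b c

/-- The series `s • Y₁ ^ a * Y₂ ^ b`. -/
def single (t : k) (a b : ℕ) (s : k) : Series t := ofCoeff t fun p => if p = (a, b) then s else 0

theorem coeff_single (a b : ℕ) (s : k) (p : ℕ × ℕ) :
    coeff p (single t a b s) = if p = (a, b) then s else 0 := rfl

theorem coeff_mul_eq_zero {F G : Series t} {p : ℕ × ℕ}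
    (h : ∀ x y, x + y = p → coeff x F = 0 ∨ coeff y G = 0) : coeff p (F * G) = 0 := by
  rw [coeff_mul]
  refine sum_eq_zero fun x hx => sum_eq_zero fun y hy => ?_
  rw [HasAntidiagonal.mem_antidiagonal] at hx hy
  rcases h (x.1, y.1) (x.2, y.2) (Prod.ext hx hy) with h | h <;> simp [h]

theorem coeff_mul_single (F : Series t) (a b : ℕ) (s : k) (p : ℕ × ℕ) :
    coeff (p + (a, b)) (F * single t a b s) = t ^ (p.2 * a) * coeff p F * s := by
  rw [coeff_mul, sum_eq_single (p.1, a), sum_eq_single (p.2, b)]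
  · simp [coeff_single]
  · rintro ⟨c, d⟩ h h'
    rw [HasAntidiagonal.mem_antidiagonal] at h
    have : d ≠ b := by rintro rfl; apply h'; ext <;> simp at h ⊢; exact h
    simp [coeff_single, this]
  · simp
  · rintro ⟨c, d⟩ h h'
    rw [HasAntidiagonal.mem_antidiagonal] at h
    have : d ≠ a := by rintro rfl; apply h'; ext <;> simp at h ⊢; exact h
    simp [coeff_single, this]
  · simp

theorem coeff_single_mul (F : Series t) (a b : ℕ) (s : k) (p : ℕ × ℕ) :
    coeff ((a, b) + p) (single t a b s * F) = t ^ (b * p.1) * s * coeff p F := by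
  rw [coeff_mul, sum_eq_single (a, p.1), sum_eq_single (b, p.2)]
  · simp [coeff_single]
  · rintro ⟨c, d⟩ h h'
    rw [HasAntidiagonal.mem_antidiagonal] at h
    have : c ≠ b := by rintro rfl; apply h'; ext <;> simp at h ⊢; exact h
    simp [coeff_single, this]
  · simp
  · rintro ⟨c, d⟩ h h'
    rw [HasAntidiagonal.mem_antidiagonal] at h
    have : c ≠ a := by rintro rfl; apply h'; ext <;> simp at h ⊢; exact h
    simp [coeff_single, this]
  · simp

theorem one_eq_single : (1 : Series t) = single t 0 0 1 := rfl

instance : Ring (Series t) where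
  __ := (inferInstance : AddCommGroup (Series t))
  mul_assoc := Series.mul_assoc
  one_mul F := by
    ext p
    simpa [one_eq_single, Prod.mk_zero_zero] using coeff_single_mul F 0 0 1 p
  mul_one F := by
    ext p
    simpa [one_eq_single, Prod.mk_zero_zero] using coeff_mul_single F 0 0 1 p
  zero_mul F := by ext p; simp [coeff_mul]
  mul_zero F := by ext p; simp [coeff_mul]
  left_distrib F G H := by ext p; simp [coeff_mul, mul_add, sum_add_distrib]
  right_distrib F G H := by ext p; simp [coeff_mul, mul_add, add_mul, sum_add_distrib]

instance : Algebra k (Series t) := Algebra.ofModule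
  (fun c F G => by
    ext p
    simp only [coeff_mul, map_smul, smul_eq_mul, mul_sum]
    exact sum_congr rfl fun _ _ => sum_congr rfl fun _ _ => by ring)
  (fun c F G => by
    ext p
    simp only [coeff_mul, map_smul, smul_eq_mul, mul_sum]
    exact sum_congr rfl fun _ _ => sum_congr rfl fun _ _ => by ring)

/-! ### The filtration by total degree -/

/-- The series without terms of total degree less than `n`. -/
def fil (t : k) (n : ℕ) : Submodule k (Series t) where
  carrier := {F | ∀ p : ℕ × ℕ, p.1 + p.2 < n → coeff p F = 0}
  add_mem' hF hG p hp := by rw [map_add, hF p hp, hG p hp, add_zero]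
  zero_mem' p _ := map_zero _
  smul_mem' c F hF p hp := by rw [map_smul, hF p hp, smul_zero]

theorem fil_anti {m n : ℕ} (h : m ≤ n) {F : Series t} (hF : F ∈ fil t n) : F ∈ fil t m :=
  fun p hp => hF p (hp.trans_le h)

theorem mem_fil_zero (F : Series t) : F ∈ fil t 0 := fun _ hp => absurd hp (Nat.not_lt_zero _)

theorem mul_mem_fil {m n : ℕ} {F G : Series t} (hF : F ∈ fil t m) (hG : G ∈ fil t n) :
    F * G ∈ fil t (m + n) := by
  intro p hp
  refine coeff_mul_eq_zero fun x y hxy => ?_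
  subst hxy
  by_cases hx : x.1 + x.2 < m
  · exact Or.inl (hF x hx)
  · exact Or.inr (hG y (by simp only [Prod.fst_add, Prod.snd_add] at hp; omega))

theorem mul_mem_fil_left {n : ℕ} (F : Series t) {G : Series t} (hG : G ∈ fil t n) :
    F * G ∈ fil t n := by
  simpa using mul_mem_fil (mem_fil_zero F) hG

theorem mul_mem_fil_right {n : ℕ} {F : Series t} (G : Series t) (hF : F ∈ fil t n) :
    F * G ∈ fil t n := by
  simpa using mul_mem_fil hF (mem_fil_zero G)

theorem pow_mem_fil {F : Series t} (hF : F ∈ fil t 1) (n : ℕ) : F ^ n ∈ fil t n := by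
  induction n with
  | zero => exact mem_fil_zero _
  | succ n ih => rw [pow_succ]; exact mul_mem_fil ih hF

theorem single_mem_fil (a b : ℕ) (s : k) : single t a b s ∈ fil t (a + b) := by
  rintro ⟨c, d⟩ hp
  rw [coeff_single, if_neg]
  rintro h
  simp only [Prod.mk.injEq] at h
  simp only at hp
  omega

theorem eq_zero_of_mem_fil {F : Series t} (h : ∀ n, F ∈ fil t n) : F = 0 := by
  ext p
  exact h (p.1 + p.2 + 1) p (Nat.lt_succ_self _)

theorem eq_of_sub_mem_fil {F G : Series t} (h : ∀ n, F - G ∈ fil t n) : F = G :=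
  sub_eq_zero.mp (eq_zero_of_mem_fil h)

theorem mul_sub_mul_mem_fil {n : ℕ} {F F' G G' : Series t} (hF : F - F' ∈ fil t n)
    (hG : G - G' ∈ fil t n) : F * G - F' * G' ∈ fil t n := by
  have h : F * G - F' * G' = F * (G - G') + (F - F') * G' := by noncomm_ring
  rw [h]
  exact add_mem (mul_mem_fil_left _ hG) (mul_mem_fil_right _ hF)

/-! ### Coefficientwise limits -/

/-- The coefficientwise limit of a sequence of series whose terms of total degree at most `n`
are stationary from the index `n` on. -/
def lim (P : ℕ → Series t) : Series t := ofCoeff t fun p => coeff p (P (p.1 + p.2))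

theorem sub_lim_mem_fil {P : ℕ → Series t} (hP : ∀ n, P (n + 1) - P n ∈ fil t (n + 1)) (n : ℕ) :
    P n - lim P ∈ fil t (n + 1) := by
  intro p hp
  have h : ∀ m, coeff p (P (p.1 + p.2 + m)) = coeff p (P (p.1 + p.2)) := by
    intro m
    induction m with
    | zero => rfl
    | succ m ih =>
      have := hP (p.1 + p.2 + m) p (by omega)
      rw [map_sub, sub_eq_zero] at this
      exact this.trans ih
  have := h (n - (p.1 + p.2))
  rw [Nat.add_sub_cancel' (by omega)] at this
  rw [map_sub, this, lim, coeff_ofCoeff, sub_self]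

/-! ### Supports -/

theorem coeff_ne_zero_mul {P Q R : ℕ × ℕ → Prop} {F G : Series t}
    (hF : ∀ p, coeff p F ≠ 0 → P p) (hG : ∀ p, coeff p G ≠ 0 → Q p)
    (h : ∀ x y, P x → Q y → R (x + y)) (p : ℕ × ℕ) (hp : coeff p (F * G) ≠ 0) : R p := by
  by_contra hR
  refine hp (coeff_mul_eq_zero fun x y hxy => ?_)
  by_contra! h'
  exact hR (hxy ▸ h x y (hF x h'.1) (hG y h'.2))

/-- The series whose exponents lie in a given submonoid of `ℕ × ℕ`. -/
def supported (t : k) (S : AddSubmonoid (ℕ × ℕ)) : Subalgebra k (Series t) where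
  carrier := {F | ∀ p, coeff p F ≠ 0 → p ∈ S}
  add_mem' {F G} hF hG p hp := by
    by_contra h
    exact hp (by rw [map_add, not_not.mp (mt (hF p) h), not_not.mp (mt (hG p) h), add_zero])
  mul_mem' hF hG := coeff_ne_zero_mul hF hG fun _ _ => add_mem
  algebraMap_mem' c p hp := by
    rw [Algebra.algebraMap_eq_smul_one, map_smul, coeff_one] at hp
    have : p = (0, 0) := by
      by_contra h
      simp [h] at hp
    rw [this]
    exact zero_mem S

theorem single_mem_supported {S : AddSubmonoid (ℕ × ℕ)} {a b : ℕ} (h : (a, b) ∈ S) (s : k) :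
    single t a b s ∈ supported t S := by
  intro p hp
  rw [coeff_single] at hp
  have : p = (a, b) := by
    by_contra h
    simp [h] at hp
  exact this ▸ h

theorem lim_mem_supported {S : AddSubmonoid (ℕ × ℕ)} {P : ℕ → Series t}
    (h : ∀ n, P n ∈ supported t S) : lim P ∈ supported t S :=
  fun p hp => h _ p hp

/-! ### Torus automorphisms -/

/-- The algebra endomorphism `Y₁ ↦ c • Y₁`, `Y₂ ↦ d • Y₂`. -/
def twist (t c d : k) : Series t →ₐ[k] Series t :=
  AlgHom.ofLinearMap
    { toFun := fun F => ofCoeff t fun p => c ^ p.1 * d ^ p.2 * coeff p F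
      map_add' := fun F G => by ext p; simp [mul_add]
      map_smul' := fun a F => by ext p; simp [mul_left_comm] }
    (by
      ext p
      by_cases h : p = (0, 0) <;> simp [coeff_one, h])
    (fun F G => by
      ext p
      simp only [LinearMap.coe_mk, AddHom.coe_mk, coeff_ofCoeff, coeff_mul, mul_sum]
      refine sum_congr rfl fun x hx => sum_congr rfl fun y hy => ?_
      rw [HasAntidiagonal.mem_antidiagonal] at hx hy
      rw [← hx, ← hy, pow_add, pow_add]
      ring)

theorem coeff_twist (c d : k) (F : Series t) (p : ℕ × ℕ) :
    coeff p (twist t c d F) = c ^ p.1 * d ^ p.2 * coeff p F := rfl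

theorem twist_single (c d : k) (a b : ℕ) (s : k) :
    twist t c d (single t a b s) = (c ^ a * d ^ b) • single t a b s := by
  ext p
  rw [coeff_twist, map_smul, coeff_single]
  split_ifs with h <;> simp [h]

theorem twist_mem_fil (c d : k) {n : ℕ} {F : Series t} (hF : F ∈ fil t n) :
    twist t c d F ∈ fil t n := fun p hp => by rw [coeff_twist, hF p hp, mul_zero]

theorem twist_mem_supported (c d : k) {S : AddSubmonoid (ℕ × ℕ)} {F : Series t}
    (hF : F ∈ supported t S) : twist t c d F ∈ supported t S :=
  fun p hp => hF p (right_ne_zero_of_mul (coeff_twist c d F p ▸ hp))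

theorem single_mul (ht : t ≠ 0) (a b : ℕ) (s : k) (F : Series t) :
    single t a b s * F = twist t (t ^ b) (t⁻¹ ^ a) F * single t a b s := by
  ext p
  by_cases h : a ≤ p.1 ∧ b ≤ p.2
  · obtain ⟨x, rfl⟩ : ∃ x, p = x + (a, b) :=
      ⟨(p.1 - a, p.2 - b), Prod.ext (by simp [h.1]) (by simp [h.2])⟩
    rw [coeff_mul_single, add_comm, coeff_single_mul, coeff_twist]
    have : t ^ (x.2 * a) * (t⁻¹ ^ a) ^ x.2 = 1 := by
      rw [← pow_mul, mul_comm a, ← mul_pow, mul_inv_cancel₀ ht, one_pow]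
    rw [pow_mul]
    linear_combination (-(t ^ b) ^ x.1 * s * coeff x F) * this
  · rw [coeff_mul_eq_zero, coeff_mul_eq_zero]
    · rintro x y rfl
      right
      rw [coeff_single, if_neg]
      rintro rfl
      simp at h
    · rintro x y rfl
      left
      rw [coeff_single, if_neg]
      rintro rfl
      simp at h

theorem mul_single_cancel (ht : t ≠ 0) {a b : ℕ} {s : k} (hs : s ≠ 0) {F G : Series t}
    (h : F * single t a b s = G * single t a b s) : F = G := by
  ext p
  have := congrArg (coeff (p + (a, b))) h
  rw [coeff_mul_single, coeff_mul_single] at this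
  exact mul_left_cancel₀ (pow_ne_zero _ ht) (mul_right_cancel₀ hs this)

/-! ### Evaluation of power series in one variable -/

open PowerSeries in
/-- The evaluation of a power series in one variable at a series without constant term. -/
def subst (Z : Series t) (f : k⟦X⟧) : Series t := ofCoeff t fun p =>
  ∑ j ∈ range (p.1 + p.2 + 1), PowerSeries.coeff j f * coeff p (Z ^ j)

section subst

open PowerSeries

variable {Z : Series t}

theorem aeval_trunc (n : ℕ) (f : k⟦X⟧) (Z : Series t) :
    Polynomial.aeval Z (trunc n f) = ∑ j ∈ range n, PowerSeries.coeff j f • Z ^ j := by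
  rw [Polynomial.aeval_def]
  cases n with
  | zero => rw [show trunc 0 f = 0 by ext; simp]; simp
  | succ n =>
    rw [eval₂_trunc_eq_sum_range]
    simp [Algebra.smul_def]

theorem subst_sub_mem_fil (hZ : Z ∈ fil t 1) (f : k⟦X⟧) (n : ℕ) :
    subst Z f - Polynomial.aeval Z (trunc n f) ∈ fil t n := by
  intro p hp
  rw [map_sub, sub_eq_zero, aeval_trunc, map_sum, subst, coeff_ofCoeff]
  simp only [map_smul, smul_eq_mul]
  refine sum_subset (range_subset_range.mpr hp) fun j _ hj => ?_
  rw [pow_mem_fil hZ j p (by simpa using hj), mul_zero]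

theorem aeval_mem_fil (hZ : Z ∈ fil t 1) {n : ℕ} {P : Polynomial k}
    (hP : ∀ j < n, P.coeff j = 0) : Polynomial.aeval Z P ∈ fil t n := by
  rw [Polynomial.aeval_eq_sum_range]
  refine sum_mem fun j _ => ?_
  by_cases hj : j < n
  · rw [hP j hj, zero_smul]; exact zero_mem _
  · exact Submodule.smul_mem _ _ (fil_anti (by omega) (pow_mem_fil hZ j))

theorem subst_coe (hZ : Z ∈ fil t 1) (P : Polynomial k) :
    subst Z (P : k⟦X⟧) = Polynomial.aeval Z P := by
  refine eq_of_sub_mem_fil fun n => ?_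
  have h := subst_sub_mem_fil hZ (P : k⟦X⟧) n
  have h' : Polynomial.aeval Z (trunc n (P : k⟦X⟧) - P) ∈ fil t n :=
    aeval_mem_fil hZ fun j hj => by simp [coeff_trunc, hj]
  rw [map_sub] at h'
  simpa using add_mem h h'

theorem subst_mul (hZ : Z ∈ fil t 1) (f g : k⟦X⟧) : subst Z (f * g) = subst Z f * subst Z g := by
  refine eq_of_sub_mem_fil fun n => ?_
  have h₁ := subst_sub_mem_fil hZ (f * g) n
  have h₂ := mul_sub_mul_mem_fil (subst_sub_mem_fil hZ f n) (subst_sub_mem_fil hZ g n)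
  have h₃ : Polynomial.aeval Z (trunc n (f * g) - trunc n f * trunc n g) ∈ fil t n := by
    refine aeval_mem_fil hZ fun j hj => ?_
    rw [Polynomial.coeff_sub, coeff_trunc, if_pos hj, coeff_mul_eq_coeff_trunc_mul_trunc _ _ hj,
      ← Polynomial.coe_mul, Polynomial.coeff_coe, sub_self]
  rw [map_sub, map_mul (Polynomial.aeval Z)] at h₃
  have := sub_mem (add_mem h₁ h₃) h₂
  convert this using 1
  abel

theorem subst_add (f g : k⟦X⟧) : subst Z (f + g) = subst Z f + subst Z g := by
  ext p
  simp [subst, add_mul, sum_add_distrib]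

theorem subst_one (hZ : Z ∈ fil t 1) : subst Z (1 : k⟦X⟧) = 1 := by
  simpa using subst_coe hZ 1

theorem subst_X (hZ : Z ∈ fil t 1) : subst Z (X : k⟦X⟧) = Z := by
  simpa using subst_coe hZ Polynomial.X

theorem subst_pow (hZ : Z ∈ fil t 1) (f : k⟦X⟧) (n : ℕ) : subst Z (f ^ n) = subst Z f ^ n := by
  induction n with
  | zero => rw [pow_zero, pow_zero, subst_one hZ]
  | succ n ih => rw [pow_succ, pow_succ, subst_mul hZ, ih]

theorem subst_rescale (c : k) (f : k⟦X⟧) : subst Z (rescale c f) = subst (c • Z) f := by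
  ext p
  simp only [subst, coeff_ofCoeff, coeff_rescale, smul_pow, map_smul, smul_eq_mul]
  exact sum_congr rfl fun _ _ => by ring

theorem twist_subst (c d : k) (f : k⟦X⟧) : twist t c d (subst Z f) = subst (twist t c d Z) f := by
  ext p
  simp only [subst, coeff_twist, coeff_ofCoeff, ← map_pow, mul_sum]
  exact sum_congr rfl fun _ _ => by ring

theorem subst_mem_supported {S : AddSubmonoid (ℕ × ℕ)} (hZ : Z ∈ supported t S) (f : k⟦X⟧) :
    subst Z f ∈ supported t S := by
  intro p hp
  by_contra h
  refine hp ?_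
  rw [subst, coeff_ofCoeff]
  refine sum_eq_zero fun j _ => ?_
  rw [not_not.mp (mt (pow_mem hZ j p) h), mul_zero]

theorem mul_subst_of_semiconj {A Z' : Series t} (hZ : Z ∈ fil t 1) (hZ' : Z' ∈ fil t 1)
    (h : A * Z = Z' * A) (f : k⟦X⟧) : A * subst Z f = subst Z' f * A := by
  refine eq_of_sub_mem_fil fun n => ?_
  have h₁ := mul_mem_fil_left A (subst_sub_mem_fil hZ f n)
  have h₂ := mul_mem_fil_right A (subst_sub_mem_fil hZ' f n)
  have h₃ : A * Polynomial.aeval Z (trunc n f) = Polynomial.aeval Z' (trunc n f) * A := by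
    rw [aeval_trunc, aeval_trunc, mul_sum, sum_mul]
    refine sum_congr rfl fun j _ => ?_
    rw [mul_smul_comm, smul_mul_assoc, (SemiconjBy.pow_right h j).eq]
  have := sub_mem h₁ h₂
  rw [mul_sub, sub_mul, h₃] at this
  simpa using this

theorem subst_sub_one_mem_fil {n : ℕ} (hZ : Z ∈ fil t n) {f : k⟦X⟧}
    (hf : constantCoeff f = 1) : subst Z f - 1 ∈ fil t n := by
  intro p hp
  have h : ∀ j ∈ range (p.1 + p.2 + 1), j ≠ 0 →
      PowerSeries.coeff j f * coeff p (Z ^ j) = 0 := by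
    intro j _ hj
    obtain ⟨i, rfl⟩ := Nat.exists_eq_succ_of_ne_zero hj
    rw [pow_succ, mul_mem_fil_left _ hZ p hp, mul_zero]
  rw [map_sub, subst, coeff_ofCoeff, sum_eq_single 0 h (by simp)]
  simp [hf]

/-- A series with constant term `1` has a two-sided inverse, in any subalgebra of series with
restricted support that contains it. -/
theorem exists_inverse {S : AddSubmonoid (ℕ × ℕ)} {F : Series t} (hF : F - 1 ∈ fil t 1)
    (hS : F ∈ supported t S) :
    ∃ G ∈ supported t S, G - 1 ∈ fil t 1 ∧ F * G = 1 ∧ G * F = 1 := by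
  have hN : 1 - F ∈ fil t 1 := by simpa using neg_mem hF
  have h : subst (1 - F) (1 - X : k⟦X⟧) = F := by
    have := subst_coe hN (1 - Polynomial.X)
    simpa using this
  have h' : (1 - X : k⟦X⟧) * PowerSeries.mk 1 = 1 := by
    rw [mul_comm]; exact mk_one_mul_one_sub_eq_one k
  refine ⟨subst (1 - F) (PowerSeries.mk 1), subst_mem_supported (sub_mem (one_mem _) hS) _,
    subst_sub_one_mem_fil hN (by simp), ?_, ?_⟩
  · have := subst_mul hN (1 - X : k⟦X⟧) (PowerSeries.mk 1)
    rwa [h', subst_one hN, h, eq_comm] at this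
  · have := subst_mul hN (PowerSeries.mk 1) (1 - X : k⟦X⟧)
    rwa [mul_comm, h', subst_one hN, h, eq_comm] at this

end subst

end Series

/-! ### The quantum dilogarithm as a power series in one variable -/

section dilog

open PowerSeries

/-- The exponential of a power series without constant term. -/
def expSeries (f : k⟦X⟧) : k⟦X⟧ :=
  PowerSeries.mk fun n => ∑ i ∈ range (n + 1), ((i.factorial : k))⁻¹ * coeff n (f ^ i)

theorem coeff_pow_eq_zero {f : k⟦X⟧} (hf : constantCoeff f = 0) {i n : ℕ} (h : n < i) :
    coeff n (f ^ i) = 0 :=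
  coeff_of_lt_order _ ((Nat.cast_lt.mpr h).trans_le (le_order_pow_of_constantCoeff_eq_zero i hf))

theorem coeff_expSeries {f : k⟦X⟧} (hf : constantCoeff f = 0) {n N : ℕ} (h : n < N) :
    coeff n (expSeries f) = ∑ i ∈ range N, ((i.factorial : k))⁻¹ * coeff n (f ^ i) := by
  rw [expSeries, coeff_mk]
  refine sum_subset (range_subset_range.mpr h) fun i _ hi => ?_
  rw [coeff_pow_eq_zero hf (by simpa using hi), mul_zero]

theorem constantCoeff_expSeries (f : k⟦X⟧) : constantCoeff (expSeries f) = 1 := by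
  rw [← coeff_zero_eq_constantCoeff_apply, expSeries, coeff_mk]
  simp

theorem derivative_expSeries [CharZero k] {f : k⟦X⟧} (hf : constantCoeff f = 0) :
    d⁄dX k (expSeries f) = d⁄dX k f * expSeries f := by
  ext n
  have h₁ : coeff n (d⁄dX k (expSeries f)) =
      coeff n (d⁄dX k (∑ i ∈ range (n + 2), ((i.factorial : k))⁻¹ • f ^ i)) := by
    rw [coeff_derivative, coeff_derivative, coeff_expSeries hf (Nat.lt_succ_self _), map_sum]
    simp
  have h₂ : coeff n (d⁄dX k f * expSeries f) =
      coeff n (d⁄dX k f * ∑ i ∈ range (n + 1), ((i.factorial : k))⁻¹ • f ^ i) := by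
    rw [PowerSeries.coeff_mul, PowerSeries.coeff_mul]
    refine sum_congr rfl fun x hx => ?_
    rw [HasAntidiagonal.mem_antidiagonal] at hx
    rw [coeff_expSeries hf (show x.2 < n + 1 by omega), map_sum]
    simp
  rw [h₁, h₂, map_sum, sum_range_succ', mul_sum]
  congr 1
  simp only [pow_zero, Derivation.map_smul, derivative_one, smul_zero, add_zero]
  refine sum_congr rfl fun i _ => ?_
  rw [derivative_pow, Nat.add_sub_cancel, mul_smul_comm, Nat.factorial_succ,
    Nat.cast_mul, mul_inv]
  have : ((i + 1 : ℕ) : k) ≠ 0 := Nat.cast_ne_zero.mpr i.succ_ne_zero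
  rw [show ((i + 1 : ℕ) : k⟦X⟧) = C ((i + 1 : ℕ) : k) by simp, mul_assoc, ← smul_eq_C_mul,
    smul_smul, mul_right_comm, inv_mul_cancel₀ this, one_mul, mul_comm]

theorem eq_of_derivative_eq_mul [CharZero k] {a f g : k⟦X⟧} (hf : d⁄dX k f = a * f)
    (hg : d⁄dX k g = a * g) (h : constantCoeff f = constantCoeff g) : f = g := by
  ext n
  induction n using Nat.strong_induction_on with
  | _ n ih =>
    cases n with
    | zero => simpa using h
    | succ n =>
      have h₁ := congrArg (coeff n) hf
      have h₂ := congrArg (coeff n) hg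
      rw [coeff_derivative, PowerSeries.coeff_mul] at h₁ h₂
      have h₃ : ((n : k) + 1) ≠ 0 := Nat.cast_add_one_ne_zero n
      refine mul_right_cancel₀ h₃ (h₁.trans (Eq.trans ?_ h₂.symm))
      refine sum_congr rfl fun x hx => ?_
      rw [HasAntidiagonal.mem_antidiagonal] at hx
      rw [ih x.2 (by omega)]

theorem derivative_rescale (c : k) (f : k⟦X⟧) :
    d⁄dX k (rescale c f) = C c * rescale c (d⁄dX k f) := by
  ext n
  simp only [coeff_derivative, coeff_rescale, coeff_C_mul]
  ring

/-- The logarithm of the quantum dilogarithm. -/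
def dilogArg (w : k) : k⟦X⟧ :=
  PowerSeries.mk fun j => (-1) ^ (j + 1) / (j * (w ^ j - w⁻¹ ^ j))

/-- The quantum dilogarithm `Ψ_w` as a power series in one variable. -/
def dilog (w : k) : k⟦X⟧ := expSeries (dilogArg w)

theorem constantCoeff_dilogArg (w : k) : constantCoeff (dilogArg w) = 0 := by
  rw [← coeff_zero_eq_constantCoeff_apply, dilogArg, coeff_mk]
  simp

theorem constantCoeff_dilog (w : k) : constantCoeff (dilog w) = 1 := constantCoeff_expSeries _

theorem rescale_dilog [CharZero k] {w : k} (hw' : ∀ n : ℕ, 0 < n → w ^ n ≠ w⁻¹ ^ n) :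
    rescale w (dilog w) = (1 + X) * rescale w⁻¹ (dilog w) := by
  set f := d⁄dX k (dilogArg w) with hf
  have hd : d⁄dX k (dilog w) = f * dilog w := derivative_expSeries (constantCoeff_dilogArg w)
  have hlog : (1 + X) * (C w * rescale w f - C w⁻¹ * rescale w⁻¹ f) = 1 := by
    have : C w * rescale w f - C w⁻¹ * rescale w⁻¹ f = rescale (-1) (PowerSeries.mk 1) := by
      ext n
      have h₁ := sub_ne_zero.mpr (hw' (n + 1) n.succ_pos)
      have h₂ : ((n : k) + 1) ≠ 0 := Nat.cast_add_one_ne_zero n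
      simp only [hf, map_sub, coeff_C_mul, coeff_rescale, coeff_derivative, dilogArg, coeff_mk,
        Nat.cast_add, Nat.cast_one, Pi.one_apply]
      have : (-1 : k) ^ (n + 1 + 1) / (((n : k) + 1) * (w ^ (n + 1) - w⁻¹ ^ (n + 1))) *
          ((n : k) + 1) = (-1) ^ n / (w ^ (n + 1) - w⁻¹ ^ (n + 1)) := by
        rw [pow_succ, pow_succ]
        field_simp
      rw [this, ← mul_assoc, ← mul_assoc, ← pow_succ', ← pow_succ', ← sub_mul, mul_one,
        mul_div_cancel₀ _ h₁]
    rw [this, show (1 + X : k⟦X⟧) = rescale (-1) (1 - X) by simp [rescale_X], ← map_mul,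
      mul_comm, mk_one_mul_one_sub_eq_one, map_one]
  refine eq_of_derivative_eq_mul (a := C w * rescale w f) ?_ ?_ ?_
  · rw [derivative_rescale, hd, map_mul, mul_assoc]
  · rw [Derivation.leibniz, derivative_rescale, hd, map_mul]
    simp only [map_add, derivative_one, derivative_X, smul_eq_mul]
    linear_combination (-rescale w⁻¹ (dilog w)) * hlog
  · have hc : ∀ c, constantCoeff (rescale c (dilog w)) = 1 := fun c => by
      rw [← coeff_zero_eq_constantCoeff_apply, coeff_rescale, pow_zero, one_mul,
        coeff_zero_eq_constantCoeff_apply, constantCoeff_dilog]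
    simp [hc]

end dilog

namespace Series

variable {t : k}

theorem coeff_subst_expSeries {Z : Series t} (hZ : Z ∈ fil t 1) {f : PowerSeries k}
    (hf : PowerSeries.constantCoeff f = 0) (p : ℕ × ℕ) :
    coeff p (subst Z (expSeries f)) =
      ∑ i ∈ range (p.1 + p.2 + 1), ((i.factorial : k))⁻¹ * coeff p (subst Z f ^ i) := by
  have h : ∀ j ∈ range (p.1 + p.2 + 1),
      PowerSeries.coeff j (expSeries f) * coeff p (Z ^ j) =
        ∑ i ∈ range (p.1 + p.2 + 1),
          ((i.factorial : k))⁻¹ * PowerSeries.coeff j (f ^ i) * coeff p (Z ^ j) := by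
    intro j hj
    rw [coeff_expSeries hf (mem_range.mp hj), sum_mul]
  rw [subst, coeff_ofCoeff, sum_congr rfl h, sum_comm]
  refine sum_congr rfl fun i _ => ?_
  rw [← subst_pow hZ, subst, coeff_ofCoeff, mul_sum]
  exact sum_congr rfl fun j _ => mul_assoc _ _ _

/-- The quantum dilogarithm of a series without constant term. -/
def Psi (w : k) (Z : Series t) : Series t := subst Z (dilog w)

theorem Psi_smul [CharZero k] {w : k} (hw' : ∀ n : ℕ, 0 < n → w ^ n ≠ w⁻¹ ^ n)
    {Z : Series t} (hZ : Z ∈ fil t 1) : Psi w (w • Z) = (1 + Z) * Psi w (w⁻¹ • Z) := by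
  have h := congrArg (subst Z) (rescale_dilog hw')
  rw [subst_mul hZ, subst_rescale, subst_rescale, subst_add, subst_one hZ, subst_X hZ] at h
  exact h

theorem Psi_sub_one_mem_fil (w : k) {n : ℕ} {Z : Series t} (hZ : Z ∈ fil t n) :
    Psi w Z - 1 ∈ fil t n := subst_sub_one_mem_fil hZ (constantCoeff_dilog w)

theorem Psi_mem_supported (w : k) {S : AddSubmonoid (ℕ × ℕ)} {Z : Series t}
    (hZ : Z ∈ supported t S) : Psi w Z ∈ supported t S := subst_mem_supported hZ _

theorem twist_Psi (c d w : k) (Z : Series t) : twist t c d (Psi w Z) = Psi w (twist t c d Z) :=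
  twist_subst c d _

theorem mul_Psi_of_semiconj (w : k) {A Z Z' : Series t} (hZ : Z ∈ fil t 1) (hZ' : Z' ∈ fil t 1)
    (h : A * Z = Z' * A) : A * Psi w Z = Psi w Z' * A := mul_subst_of_semiconj hZ hZ' h _

section steps

variable [CharZero k] {q : k}

/-- The functional equation of the quantum dilogarithm moves `1 + q⁻¹ W + D` past `Ψ_q(W)`
when `D` and `W` commute up to `q⁻⁴`. -/
theorem Psi_lower_step (hq : q ≠ 0) (hq' : ∀ n : ℕ, 0 < n → q ^ n ≠ q⁻¹ ^ n)
    {W W' D : Series t} (hW : W ∈ fil t 1) (h₁ : D * W = q⁻¹ ^ 2 • W') (h₂ : W * D = q ^ 2 • W') :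
    Psi q (q⁻¹ ^ 2 • W) * (1 + q⁻¹ • W + D) = (1 + q⁻¹ • W' + D) * Psi q W := by
  have hs : ∀ c : k, c • W ∈ fil t 1 := fun c => Submodule.smul_mem _ c hW
  have e₁ := Psi_smul hq' (hs q⁻¹)
  rw [smul_smul, smul_smul, mul_inv_cancel₀ hq, one_smul, ← pow_two] at e₁
  have e₂ := Psi_smul hq' (hs q)
  rw [smul_smul, smul_smul, inv_mul_cancel₀ hq, one_smul, ← pow_two] at e₂
  have e₃ : Psi q (q⁻¹ ^ 2 • W) * D = D * Psi q (q ^ 2 • W) := by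
    refine (mul_Psi_of_semiconj q (hs _) (hs _) ?_).symm
    rw [mul_smul_comm, smul_mul_assoc, h₁, h₂, smul_comm]
  have e₄ : Psi q (q⁻¹ ^ 2 • W) * (q⁻¹ • W) = (q⁻¹ • W) * Psi q (q⁻¹ ^ 2 • W) := by
    refine (mul_Psi_of_semiconj q (hs _) (hs _) ?_).symm
    rw [smul_mul_smul_comm, smul_mul_smul_comm, mul_comm q⁻¹]
  have e₅ : Psi q (q⁻¹ ^ 2 • W) + (q⁻¹ • W) * Psi q (q⁻¹ ^ 2 • W) = Psi q W := by
    conv_rhs => rw [e₁]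
    rw [add_mul, one_mul]
  have e₆ : D * (q • W) = q⁻¹ • W' := by
    rw [mul_smul_comm, h₁, smul_smul]
    congr 1
    field_simp
  rw [mul_add, mul_add, mul_one, e₄, e₅, e₃, e₂, ← mul_assoc, mul_add D, mul_one, e₆, add_mul,
    add_mul, add_mul, one_mul]
  abel

/-- The functional equation of the quantum dilogarithm moves `1 + q V + D` past `Ψ_q(V)`
when `D` and `V` commute up to `q⁴`. -/
theorem Psi_upper_step (hq : q ≠ 0) (hq' : ∀ n : ℕ, 0 < n → q ^ n ≠ q⁻¹ ^ n)
    {V V' D : Series t} (hV : V ∈ fil t 1) (h₁ : V * D = q⁻¹ ^ 2 • V') (h₂ : D * V = q ^ 2 • V') :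
    Psi q (q ^ 2 • V) * (1 + q • V' + D) = (1 + q • V + D) * Psi q V := by
  have hs : ∀ c : k, c • V ∈ fil t 1 := fun c => Submodule.smul_mem _ c hV
  have e₁ := Psi_smul hq' (hs q)
  rw [smul_smul, smul_smul, inv_mul_cancel₀ hq, one_smul, ← pow_two] at e₁
  have e₂ := Psi_smul hq' (hs (q ^ 3))
  rw [smul_smul, smul_smul, show q * q ^ 3 = q ^ 4 by ring,
    show q⁻¹ * q ^ 3 = q ^ 2 by field_simp] at e₂
  have e₃ : D * Psi q V = Psi q (q ^ 4 • V) * D := by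
    refine mul_Psi_of_semiconj q hV (hs _) ?_
    rw [smul_mul_assoc, h₁, h₂, smul_smul]
    congr 1
    field_simp
  have e₄ : (q ^ 3 • V) * Psi q (q ^ 2 • V) = Psi q (q ^ 2 • V) * (q ^ 3 • V) := by
    refine mul_Psi_of_semiconj q (hs _) (hs _) ?_
    rw [smul_mul_smul_comm, smul_mul_smul_comm, mul_comm (q ^ 3)]
  rw [add_mul _ D, ← e₁, e₃, e₂, add_mul 1, one_mul, e₄, add_mul, mul_assoc, smul_mul_assoc, h₁,
    smul_smul, show q ^ 3 * q⁻¹ ^ 2 = q by field_simp, mul_add, mul_add, mul_one]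
  abel

theorem Psi_mul_Psi_shift {w : k} (hw : w ≠ 0) (hw' : ∀ n : ℕ, 0 < n → w ^ n ≠ w⁻¹ ^ n)
    {Z : Series t} (hZ : Z ∈ fil t 1) :
    Psi w (w • Z) * Psi w (w ^ 3 • Z) =
      (1 + Z) * (1 + w ^ 2 • Z) * (Psi w (w⁻¹ • Z) * Psi w (w • Z)) := by
  have hs : ∀ c : k, c • Z ∈ fil t 1 := fun c => Submodule.smul_mem _ c hZ
  have e₁ := Psi_smul hw' (hs (w ^ 2))
  rw [smul_smul, smul_smul, ← pow_succ', show w⁻¹ * w ^ 2 = w by field_simp] at e₁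
  have e₂ : (w ^ 2 • Z) * Psi w (w⁻¹ • Z) = Psi w (w⁻¹ • Z) * (w ^ 2 • Z) := by
    refine mul_Psi_of_semiconj w (hs _) (hs _) ?_
    rw [smul_mul_smul_comm, smul_mul_smul_comm, mul_comm (w ^ 2)]
  have e₃ : (1 + w ^ 2 • Z) * Psi w (w⁻¹ • Z) = Psi w (w⁻¹ • Z) * (1 + w ^ 2 • Z) := by
    rw [add_mul, mul_add, e₂, one_mul, mul_one]
  rw [e₁, mul_assoc, ← mul_assoc _ (Psi w (w⁻¹ • Z)), e₃]
  nth_rw 1 [Psi_smul hw' hZ]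
  simp only [mul_assoc]

end steps

/-! ### Series supported above, below and on the diagonal -/

/-- The exponents strictly above the diagonal, together with `0`. -/
def lowerCone : AddSubmonoid (ℕ × ℕ) where
  carrier := {p | p = 0 ∨ p.1 < p.2}
  zero_mem' := Or.inl rfl
  add_mem' := by
    rintro x y (rfl | hx) (rfl | hy)
    · exact Or.inl (add_zero 0)
    · exact Or.inr (by simpa using hy)
    · exact Or.inr (by simpa using hx)
    · exact Or.inr (by simp only [Prod.fst_add, Prod.snd_add]; omega)

/-- The exponents strictly below the diagonal, together with `0`. -/
def upperCone : AddSubmonoid (ℕ × ℕ) where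
  carrier := {p | p = 0 ∨ p.2 < p.1}
  zero_mem' := Or.inl rfl
  add_mem' := by
    rintro x y (rfl | hx) (rfl | hy)
    · exact Or.inl (add_zero 0)
    · exact Or.inr (by simpa using hy)
    · exact Or.inr (by simpa using hx)
    · exact Or.inr (by simp only [Prod.fst_add, Prod.snd_add]; omega)

/-- The exponents on the diagonal. -/
def diagCone : AddSubmonoid (ℕ × ℕ) where
  carrier := {p | p.1 = p.2}
  zero_mem' := rfl
  add_mem' {x y} hx hy := by
    simp only [Set.mem_ofPred_eq, Prod.fst_add, Prod.snd_add] at *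
    omega

theorem mem_lowerCone {p : ℕ × ℕ} : p ∈ lowerCone ↔ p = 0 ∨ p.1 < p.2 := Iff.rfl

theorem mem_upperCone {p : ℕ × ℕ} : p ∈ upperCone ↔ p = 0 ∨ p.2 < p.1 := Iff.rfl

theorem mem_diagCone {p : ℕ × ℕ} : p ∈ diagCone ↔ p.1 = p.2 := Iff.rfl

theorem ne_zero_of_coeff_ne_zero {F : Series t} (hF : F ∈ fil t 1) {p : ℕ × ℕ}
    (hp : coeff p F ≠ 0) : p ≠ 0 := by
  rintro rfl
  exact hp (hF 0 Nat.one_pos)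

theorem lt_of_mem_lowerCone {F : Series t} (h : F - 1 ∈ fil t 1)
    (hF : F ∈ supported t lowerCone) (p : ℕ × ℕ) (hp : coeff p (F - 1) ≠ 0) : p.1 < p.2 :=
  (sub_mem hF (one_mem _) p hp).resolve_left (ne_zero_of_coeff_ne_zero h hp)

theorem lt_of_mem_upperCone {F : Series t} (h : F - 1 ∈ fil t 1)
    (hF : F ∈ supported t upperCone) (p : ℕ × ℕ) (hp : coeff p (F - 1) ≠ 0) : p.2 < p.1 :=
  (sub_mem hF (one_mem _) p hp).resolve_left (ne_zero_of_coeff_ne_zero h hp)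

theorem diag_commute {F G : Series t} (hF : F ∈ supported t diagCone)
    (hG : G ∈ supported t diagCone) : F * G = G * F := by
  ext p
  rw [coeff_mul, coeff_mul, ← Nat.sum_antidiagonal_swap (n := p.1)]
  refine sum_congr rfl fun x _ => ?_
  rw [← Nat.sum_antidiagonal_swap (n := p.2)]
  refine sum_congr rfl fun y _ => ?_
  simp only [Prod.fst_swap, Prod.snd_swap]
  by_cases h₁ : coeff (x.2, y.2) F = 0
  · simp [h₁]
  by_cases h₂ : coeff (x.1, y.1) G = 0
  · simp [h₂]
  have h₁ := mem_diagCone.mp (hF _ h₁)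
  have h₂ := mem_diagCone.mp (hG _ h₂)
  simp only at h₁ h₂
  rw [h₁, h₂, mul_comm y.2 y.1]
  ring

/-- The part of a series on the first superdiagonal. -/
def superdiag : Series t →ₗ[k] Series t where
  toFun F := ofCoeff t fun p => if p.2 = p.1 + 1 then coeff p F else 0
  map_add' F G := by ext p; simp only [coeff_ofCoeff, map_add]; split_ifs <;> simp
  map_smul' c F := by ext p; simp

theorem coeff_superdiag (F : Series t) (p : ℕ × ℕ) :
    coeff p (superdiag F) = if p.2 = p.1 + 1 then coeff p F else 0 := rfl

theorem superdiag_eq_self {F : Series t} (h : ∀ p, coeff p F ≠ 0 → p.2 = p.1 + 1) :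
    superdiag F = F := by
  ext p
  rw [coeff_superdiag]
  split_ifs with hp
  · rfl
  · exact (not_not.mp (mt (h p) hp)).symm

theorem superdiag_eq_zero {F : Series t} (h : ∀ p, coeff p F ≠ 0 → p.2 ≠ p.1 + 1) :
    superdiag F = 0 := by
  ext p
  rw [coeff_superdiag, map_zero]
  split_ifs with hp
  · by_contra h'
    exact h p h' hp
  · rfl

theorem superdiag_coeff_ne_zero (F : Series t) (p : ℕ × ℕ) (hp : coeff p (superdiag F) ≠ 0) :
    p.2 = p.1 + 1 := by
  by_contra h
  exact hp (by rw [coeff_superdiag, if_neg h])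

theorem sub_superdiag_coeff_ne_zero (F : Series t) (p : ℕ × ℕ)
    (hp : coeff p (F - superdiag F) ≠ 0) : p.2 ≠ p.1 + 1 := by
  intro h
  exact hp (by rw [map_sub, coeff_superdiag, if_pos h, sub_self])

theorem superdiag_twist (c d : k) (F : Series t) :
    superdiag (twist t c d F) = twist t c d (superdiag F) := by
  ext p
  simp [coeff_superdiag, coeff_twist]

theorem superdiag_one : superdiag (1 : Series t) = 0 :=
  superdiag_eq_zero fun p hp h => by
    have := mem_diagCone.mp (one_mem (supported t diagCone) p hp)
    omega

theorem superdiag_single (s : k) : superdiag (single t 0 1 s) = single t 0 1 s :=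
  superdiag_eq_self fun p hp => by
    rw [coeff_single] at hp
    split_ifs at hp with h
    · simp [h]
    · exact absurd rfl hp

theorem superdiag_diag_mul {D : Series t} (hD : D ∈ supported t diagCone) (F : Series t) :
    superdiag (D * F) = D * superdiag F := by
  have h₁ : superdiag (D * superdiag F) = D * superdiag F :=
    superdiag_eq_self (coeff_ne_zero_mul hD (superdiag_coeff_ne_zero F) fun x y hx hy => by
      rw [mem_diagCone] at hx
      simp only [Prod.fst_add, Prod.snd_add]; omega)
  have h₂ : superdiag (D * (F - superdiag F)) = 0 :=
    superdiag_eq_zero (coeff_ne_zero_mul hD (sub_superdiag_coeff_ne_zero F) fun x y hx hy => by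
      rw [mem_diagCone] at hx
      simp only [Prod.fst_add, Prod.snd_add]; omega)
  rwa [mul_sub, map_sub, h₁, sub_eq_zero] at h₂

theorem superdiag_mul_diag {D : Series t} (hD : D ∈ supported t diagCone) (F : Series t) :
    superdiag (F * D) = superdiag F * D := by
  have h₁ : superdiag (superdiag F * D) = superdiag F * D :=
    superdiag_eq_self (coeff_ne_zero_mul (superdiag_coeff_ne_zero F) hD fun x y hx hy => by
      rw [mem_diagCone] at hy
      simp only [Prod.fst_add, Prod.snd_add]; omega)
  have h₂ : superdiag ((F - superdiag F) * D) = 0 :=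
    superdiag_eq_zero (coeff_ne_zero_mul (sub_superdiag_coeff_ne_zero F) hD fun x y hx hy => by
      rw [mem_diagCone] at hy
      simp only [Prod.fst_add, Prod.snd_add]; omega)
  rwa [sub_mul, map_sub, h₁, sub_eq_zero] at h₂

theorem superdiag_mul_lower {F G : Series t} (hF : F ∈ supported t lowerCone)
    (hG : G ∈ supported t lowerCone) (hF' : F - 1 ∈ fil t 1) (hG' : G - 1 ∈ fil t 1) :
    superdiag (F * G) = superdiag F + superdiag G := by
  have h : superdiag ((F - 1) * (G - 1)) = 0 :=
    superdiag_eq_zero (coeff_ne_zero_mul (lt_of_mem_lowerCone hF' hF) (lt_of_mem_lowerCone hG' hG)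
      fun x y hx hy => by simp only [Prod.fst_add, Prod.snd_add]; omega)
  have e : F * G = (F - 1) * (G - 1) + F + G - 1 := by noncomm_ring
  rw [e, map_sub, map_add, map_add, h, superdiag_one, zero_add, sub_zero]

theorem superdiag_upper {F : Series t} (hF : F ∈ supported t upperCone) : superdiag F = 0 :=
  superdiag_eq_zero fun p hp h => by
    rcases mem_upperCone.mp (hF p hp) with rfl | h'
    · simp at h
    · omega

theorem superdiag_lower_mul_single {F : Series t} (hF : F ∈ supported t lowerCone)
    (hF' : F - 1 ∈ fil t 1) (s : k) : superdiag (F * single t 0 1 s) = single t 0 1 s := by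
  have h := superdiag_mul_lower hF
    (add_mem (one_mem _) (single_mem_supported (Or.inr Nat.one_pos) s)) hF'
    (by simpa using single_mem_fil 0 1 s)
  rw [mul_add, mul_one, map_add, map_add, superdiag_one, zero_add, superdiag_single] at h
  exact add_left_cancel h

theorem superdiag_upper_mul_single_mul_upper {F G : Series t} (hF : F ∈ supported t upperCone)
    (hG : G ∈ supported t upperCone) (hF' : F - 1 ∈ fil t 1) (hG' : G - 1 ∈ fil t 1) (s : k) :
    superdiag (F * single t 0 1 s * G) = single t 0 1 s := by
  have hs : ∀ p, coeff p (single t 0 1 s) ≠ 0 → p.2 ≤ p.1 + 1 := fun p hp => by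
    rw [coeff_single] at hp
    split_ifs at hp with h
    · simp [h]
    · exact absurd rfl hp
  have hS : ∀ p, coeff p (single t 0 1 s * (G - 1)) ≠ 0 → p.2 ≤ p.1 :=
    coeff_ne_zero_mul hs (lt_of_mem_upperCone hG' hG) fun x y hx hy => by
      simp only [Prod.fst_add, Prod.snd_add]; omega
  have h₁ : superdiag (single t 0 1 s * (G - 1)) = 0 :=
    superdiag_eq_zero fun p hp => by have := hS p hp; omega
  have h₂ : superdiag ((F - 1) * single t 0 1 s) = 0 :=
    superdiag_eq_zero (coeff_ne_zero_mul (lt_of_mem_upperCone hF' hF) hs fun x y hx hy => by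
      simp only [Prod.fst_add, Prod.snd_add]; omega)
  have h₃ : superdiag ((F - 1) * (single t 0 1 s * (G - 1))) = 0 :=
    superdiag_eq_zero (coeff_ne_zero_mul (lt_of_mem_upperCone hF' hF) hS fun x y hx hy => by
      simp only [Prod.fst_add, Prod.snd_add]; omega)
  have e : F * single t 0 1 s * G = (F - 1) * (single t 0 1 s * (G - 1)) +
      (F - 1) * single t 0 1 s + single t 0 1 s * (G - 1) + single t 0 1 s := by noncomm_ring
  rw [e, map_add, map_add, map_add, h₁, h₂, h₃, superdiag_single]
  simp

/-- The part of a series on the diagonal. -/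
def diagPart (F : Series t) : Series t := ofCoeff t fun p => if p.1 = p.2 then coeff p F else 0

theorem coeff_diagPart (F : Series t) (p : ℕ × ℕ) :
    coeff p (diagPart F) = if p.1 = p.2 then coeff p F else 0 := rfl

theorem diagPart_mem (F : Series t) : diagPart F ∈ supported t diagCone := fun p hp => by
  by_contra h
  exact hp (by rw [coeff_diagPart, if_neg (mt mem_diagCone.mpr h)])

theorem twist_diag {c d : k} (h : c * d = 1) {D : Series t} (hD : D ∈ supported t diagCone) :
    twist t c d D = D := by
  ext p
  rw [coeff_twist]
  by_cases hp : coeff p D = 0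
  · simp [hp]
  · rw [mem_diagCone.mp (hD p hp), ← mul_pow, h, one_pow, one_mul]

/-- A series that commutes, up to a generic twist, with `1 + Z` for a diagonal series `Z` without
constant term is itself diagonal. -/
theorem mem_diag_of_twist {c d : k} (hcd : c * d = 1) (hc : ∀ n : ℕ, 0 < n → c ^ n ≠ 1)
    {F Z : Series t} (hZ : Z ∈ supported t diagCone) (hZ' : Z ∈ fil t 1)
    (h : twist t c d F * (1 + Z) = (1 + Z) * F) : F ∈ supported t diagCone := by
  have hD := diagPart_mem F
  have h₁ : twist t c d (diagPart F) * (1 + Z) = (1 + Z) * diagPart F := by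
    rw [twist_diag hcd hD, diag_commute hD (add_mem (one_mem _) hZ)]
  set G := F - diagPart F with hG
  have h₂ : twist t c d G * (1 + Z) = (1 + Z) * G := by
    rw [hG, map_sub, sub_mul, mul_sub, h, h₁]
  have h₃ : twist t c d G - G = Z * G - twist t c d G * Z := by
    rw [mul_add, add_mul, mul_one, one_mul] at h₂
    rw [sub_eq_sub_iff_add_eq_add, h₂]
    abel
  have h₄ : ∀ n, G ∈ fil t n := by
    intro n
    induction n with
    | zero => exact mem_fil_zero _
    | succ n ih =>
      intro p hp
      have h₅ : twist t c d G - G ∈ fil t (n + 1) := by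
        rw [h₃]
        refine sub_mem ?_ (mul_mem_fil (twist_mem_fil c d ih) hZ')
        rw [add_comm]
        exact mul_mem_fil hZ' ih
      by_cases hpp : p.1 = p.2
      · rw [hG, map_sub, coeff_diagPart, if_pos hpp, sub_self]
      have h₆ := h₅ p hp
      rw [map_sub, coeff_twist] at h₆
      have h₇ : c ^ p.1 * d ^ p.2 ≠ 1 := by
        rcases lt_or_gt_of_ne hpp with hlt | hlt
        · obtain ⟨m, hm⟩ := Nat.exists_eq_add_of_lt hlt
          rw [hm, add_assoc, pow_add, ← mul_assoc, ← mul_pow, hcd, one_pow, one_mul]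
          intro hd
          refine hc (m + 1) m.succ_pos ?_
          have := congrArg (c ^ (m + 1) * ·) hd
          simpa [← mul_pow, hcd] using this.symm
        · obtain ⟨m, hm⟩ := Nat.exists_eq_add_of_lt hlt
          rw [hm, add_assoc, pow_add, mul_right_comm, ← mul_pow, hcd, one_pow, one_mul]
          exact hc (m + 1) m.succ_pos
      have h₈ : (c ^ p.1 * d ^ p.2 - 1) * coeff p G = 0 := by rw [sub_mul, h₆.symm, one_mul]
      exact (mul_eq_zero.mp h₈).resolve_left (sub_ne_zero.mpr h₇)
  have h₅ : G = 0 := eq_zero_of_mem_fil h₄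
  rw [hG, sub_eq_zero] at h₅
  rw [h₅]
  exact hD

/-- A diagonal solution of a generic `q`-difference equation is determined by its constant
term. -/
theorem diag_eq_of_twist {c d : k} (hcd : ∀ n : ℕ, 0 < n → (c * d) ^ n ≠ 1) {F G A : Series t}
    (hF : F ∈ supported t diagCone) (hG : G ∈ supported t diagCone)
    (hF' : F - 1 ∈ fil t 1) (hG' : G - 1 ∈ fil t 1) (hA : A - 1 ∈ fil t 1)
    (hFA : A * twist t c d F = F) (hGA : A * twist t c d G = G) : F = G := by
  refine eq_of_sub_mem_fil fun n => ?_
  induction n with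
  | zero => exact mem_fil_zero _
  | succ n ih =>
    intro p hp
    by_cases hp0 : p.1 + p.2 = 0
    · have : F - G ∈ fil t 1 := by simpa using sub_mem hF' hG'
      exact this p (by omega)
    by_contra hne
    have hpp := mem_diagCone.mp (sub_mem hF hG p hne)
    have h₁ : (F - G) - twist t c d (F - G) ∈ fil t (n + 1) := by
      have e : (F - G) - twist t c d (F - G) = (A - 1) * twist t c d (F - G) := by
        rw [sub_mul, one_mul, map_sub, mul_sub, hFA, hGA]
      rw [e, add_comm]
      exact mul_mem_fil hA (twist_mem_fil c d ih)
    have h₂ := h₁ p hp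
    rw [map_sub, coeff_twist, hpp, ← mul_pow] at h₂
    have h₃ : (1 - (c * d) ^ p.2) * coeff p (F - G) = 0 := by rw [sub_mul, one_mul, h₂]
    exact (mul_ne_zero (sub_ne_zero.mpr (hcd p.2 (by omega)).symm) hne) h₃

theorem twist_twist (c d c' d' : k) (F : Series t) :
    twist t c d (twist t c' d' F) = twist t (c * c') (d * d') F := by
  ext p
  simp only [coeff_twist, mul_pow]
  ring

theorem add_smul_mem_fil {n : ℕ} {F : Series t} (hF : F ∈ fil t n) (c : k) (G : Series t) :
    G + c • F - G ∈ fil t n := by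
  rw [add_sub_cancel_left]
  exact Submodule.smul_mem _ c hF

section Affine

variable {q : k} {s₁ s₂ : k}

theorem pow_ne_inv_pow (hq : q ≠ 0) (hq' : ∀ n : ℕ, 0 < n → q ^ n ≠ 1) (n : ℕ) (hn : 0 < n) :
    q ^ n ≠ q⁻¹ ^ n := by
  intro h
  refine hq' (n + n) (by omega) ?_
  nth_rw 1 [pow_add, h]
  rw [← mul_pow, inv_mul_cancel₀ hq, one_pow]

/-- The normalized quantum monomials, up to powers of two auxiliary scalars. -/
def mono (q s₁ s₂ : k) (a b : ℕ) : Series (q ^ 4) :=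
  single (q ^ 4) a b (s₁ ^ a * s₂ ^ b * q ^ (2 * a * b))

theorem mono_zero : mono q s₁ s₂ 0 0 = 1 := by
  rw [mono, one_eq_single]
  simp

theorem mono_mem_fil {n a b : ℕ} (h : n ≤ a + b) : mono q s₁ s₂ a b ∈ fil (q ^ 4) n :=
  fil_anti h (single_mem_fil _ _ _)

theorem mono_mem_supported {S : AddSubmonoid (ℕ × ℕ)} {a b : ℕ} (h : (a, b) ∈ S) :
    mono q s₁ s₂ a b ∈ supported (q ^ 4) S := single_mem_supported h _

theorem single_mul_single (a b c d : ℕ) (s s' : k) :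
    single t a b s * single t c d s' = single t (a + c) (b + d) (t ^ (b * c) * s * s') := by
  ext p
  rw [coeff_single]
  split_ifs with h
  · rw [h, ← Prod.mk_add_mk, coeff_mul_single, coeff_single, if_pos rfl]
  · refine coeff_mul_eq_zero fun x y hxy => ?_
    by_contra! hne
    rw [coeff_single, coeff_single] at hne
    simp only [ne_eq, ite_eq_right_iff, Classical.not_imp] at hne
    exact h (by rw [← hxy, hne.1.1, hne.2.1]; rfl)

theorem mono_mul_mono (a b c d : ℕ) {x : k}
    (hx : x * q ^ (2 * a * d) = q ^ (2 * b * c)) :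
    mono q s₁ s₂ a b * mono q s₁ s₂ c d = x • mono q s₁ s₂ (a + c) (b + d) := by
  have h : q ^ (4 * (b * c)) = x * q ^ (2 * a * d) * q ^ (2 * b * c) := by
    rw [hx, ← pow_add]
    congr 1
    ring
  rw [mono, mono, single_mul_single, mono, ← pow_mul, h]
  ext p
  simp only [map_smul, coeff_single, smul_eq_mul, mul_ite, mul_zero]
  congr 1
  ring

theorem twist_mono (c d : k) (a b : ℕ) :
    twist (q ^ 4) c d (mono q s₁ s₂ a b) = (c ^ a * d ^ b) • mono q s₁ s₂ a b :=
  twist_single c d a b _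

theorem mono_one_pow (n : ℕ) : mono q s₁ s₂ 1 1 ^ n = mono q s₁ s₂ n n := by
  induction n with
  | zero => rw [pow_zero, mono_zero]
  | succ n ih => rw [pow_succ (mono q s₁ s₂ 1 1), ih, mono_mul_mono n n 1 1 (x := 1) (by ring), one_smul]

theorem mono_diag_mul_lower (hq : q ≠ 0) (n : ℕ) :
    mono q s₁ s₂ 1 1 * mono q s₁ s₂ n (n + 1) = q⁻¹ ^ 2 • mono q s₁ s₂ (n + 1) (n + 2) := by
  rw [mono_mul_mono 1 1 n (n + 1) (x := q⁻¹ ^ 2) (by field_simp; ring), add_comm 1 n,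
    add_comm 1 (n + 1)]

theorem mono_lower_mul_diag (n : ℕ) :
    mono q s₁ s₂ n (n + 1) * mono q s₁ s₂ 1 1 = q ^ 2 • mono q s₁ s₂ (n + 1) (n + 2) :=
  mono_mul_mono n (n + 1) 1 1 (by ring)

theorem mono_upper_mul_diag (hq : q ≠ 0) (n : ℕ) :
    mono q s₁ s₂ (n + 1) n * mono q s₁ s₂ 1 1 = q⁻¹ ^ 2 • mono q s₁ s₂ (n + 2) (n + 1) :=
  mono_mul_mono (n + 1) n 1 1 (by field_simp; ring)

theorem mono_diag_mul_upper (n : ℕ) :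
    mono q s₁ s₂ 1 1 * mono q s₁ s₂ (n + 1) n = q ^ 2 • mono q s₁ s₂ (n + 2) (n + 1) := by
  rw [mono_mul_mono 1 1 (n + 1) n (x := q ^ 2) (by ring), add_comm 1 n, add_comm 1 (n + 1)]

theorem twist_mono_lower (hq : q ≠ 0) (n : ℕ) :
    twist (q ^ 4) (q ^ 2) (q⁻¹ ^ 2) (mono q s₁ s₂ n (n + 1)) =
      q⁻¹ ^ 2 • mono q s₁ s₂ n (n + 1) := by
  rw [twist_mono]
  congr 1
  rw [pow_succ (q⁻¹ ^ 2), ← mul_assoc, ← mul_pow, ← mul_pow, mul_inv_cancel₀ hq, one_pow, one_pow, one_mul]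

theorem twist_mono_upper (hq : q ≠ 0) (n : ℕ) :
    twist (q ^ 4) (q ^ 2) (q⁻¹ ^ 2) (mono q s₁ s₂ (n + 1) n) = q ^ 2 • mono q s₁ s₂ (n + 1) n := by
  rw [twist_mono]
  congr 1
  rw [pow_succ (q ^ 2), mul_right_comm, ← mul_pow, ← mul_pow, mul_inv_cancel₀ hq, one_pow, one_pow, one_mul]

/-- The partial products of quantum dilogarithms of slope less than one. -/
def upperProd (q s₁ s₂ : k) : ℕ → Series (q ^ 4)
  | 0 => Psi q (mono q s₁ s₂ 1 0)
  | n + 1 => upperProd q s₁ s₂ n * Psi q (mono q s₁ s₂ (n + 2) (n + 1))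

/-- The partial products of quantum dilogarithms of slope greater than one. -/
def lowerProd (q s₁ s₂ : k) : ℕ → Series (q ^ 4)
  | 0 => Psi q (mono q s₁ s₂ 0 1)
  | n + 1 => Psi q (mono q s₁ s₂ (n + 1) (n + 2)) * lowerProd q s₁ s₂ n

/-- The pairs of quantum dilogarithms of slope one. -/
def diagFactor (q s₁ s₂ : k) (n : ℕ) : Series (q ^ 4) :=
  Psi (q ^ n) (q⁻¹ ^ n • mono q s₁ s₂ n n) * Psi (q ^ n) (q ^ n • mono q s₁ s₂ n n)

/-- The partial products of quantum dilogarithms of slope one. -/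
def diagProd (q s₁ s₂ : k) : ℕ → Series (q ^ 4)
  | 0 => diagFactor q s₁ s₂ 1
  | n + 1 => diagProd q s₁ s₂ n * diagFactor q s₁ s₂ (2 ^ (n + 1))

theorem mul_sub_self_mem_fil {n : ℕ} (F : Series t) {G : Series t} (hG : G - 1 ∈ fil t n) :
    F * G - F ∈ fil t n := by
  have := mul_mem_fil_left F hG
  rwa [mul_sub, mul_one] at this

theorem mul_sub_self_mem_fil' {n : ℕ} (F : Series t) {G : Series t} (hG : G - 1 ∈ fil t n) :
    G * F - F ∈ fil t n := by
  have := mul_mem_fil_right F hG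
  rwa [sub_mul, one_mul] at this

theorem mul_sub_one_mem_fil {n : ℕ} {F G : Series t} (hF : F - 1 ∈ fil t n)
    (hG : G - 1 ∈ fil t n) : F * G - 1 ∈ fil t n := by
  simpa using mul_sub_mul_mem_fil hF hG

theorem upperProd_succ_sub (n : ℕ) :
    upperProd q s₁ s₂ (n + 1) - upperProd q s₁ s₂ n ∈ fil (q ^ 4) (n + 1) :=
  mul_sub_self_mem_fil _ (Psi_sub_one_mem_fil _ (mono_mem_fil (by omega)))

theorem lowerProd_succ_sub (n : ℕ) :
    lowerProd q s₁ s₂ (n + 1) - lowerProd q s₁ s₂ n ∈ fil (q ^ 4) (n + 1) :=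
  mul_sub_self_mem_fil' _ (Psi_sub_one_mem_fil _ (mono_mem_fil (by omega)))

theorem diagFactor_sub_one {m n : ℕ} (h : m ≤ n) : diagFactor q s₁ s₂ n - 1 ∈ fil (q ^ 4) m :=
  have h' := mono_mem_fil (q := q) (s₁ := s₁) (s₂ := s₂) (n := m) (a := n) (b := n) (by omega)
  mul_sub_one_mem_fil (Psi_sub_one_mem_fil _ (Submodule.smul_mem _ _ h'))
    (Psi_sub_one_mem_fil _ (Submodule.smul_mem _ _ h'))

theorem diagProd_succ_sub (n : ℕ) :
    diagProd q s₁ s₂ (n + 1) - diagProd q s₁ s₂ n ∈ fil (q ^ 4) (n + 1) :=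
  mul_sub_self_mem_fil _ (diagFactor_sub_one Nat.lt_two_pow_self.le)

theorem upperProd_mem (n : ℕ) : upperProd q s₁ s₂ n ∈ supported (q ^ 4) upperCone := by
  induction n with
  | zero => exact Psi_mem_supported _ (mono_mem_supported (mem_upperCone.mpr (Or.inr (by simp))))
  | succ n ih =>
    exact mul_mem ih
      (Psi_mem_supported _ (mono_mem_supported (mem_upperCone.mpr (Or.inr (by simp)))))

theorem lowerProd_mem (n : ℕ) : lowerProd q s₁ s₂ n ∈ supported (q ^ 4) lowerCone := by
  induction n with
  | zero => exact Psi_mem_supported _ (mono_mem_supported (mem_lowerCone.mpr (Or.inr (by simp))))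
  | succ n ih =>
    exact mul_mem
      (Psi_mem_supported _ (mono_mem_supported (mem_lowerCone.mpr (Or.inr (by simp))))) ih

theorem diagFactor_mem (n : ℕ) : diagFactor q s₁ s₂ n ∈ supported (q ^ 4) diagCone :=
  have h := mono_mem_supported (q := q) (s₁ := s₁) (s₂ := s₂) (a := n) (b := n)
    (mem_diagCone.mpr rfl)
  mul_mem (Psi_mem_supported _ (Subalgebra.smul_mem _ h _))
    (Psi_mem_supported _ (Subalgebra.smul_mem _ h _))

theorem diagProd_mem (n : ℕ) : diagProd q s₁ s₂ n ∈ supported (q ^ 4) diagCone := by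
  induction n with
  | zero => exact diagFactor_mem 1
  | succ n ih => exact mul_mem ih (diagFactor_mem _)

theorem lim_sub_one {P : ℕ → Series t} (hP : ∀ n, P (n + 1) - P n ∈ fil t (n + 1))
    (h : P 0 - 1 ∈ fil t 1) : lim P - 1 ∈ fil t 1 := by
  simpa using sub_mem h (sub_lim_mem_fil hP 0)

theorem one_sub_mul_one_add {Z : Series t} (hZ : Z ∈ supported t diagCone) (c : k) :
    (1 - Z) * (1 - c • Z) * ((1 + Z) * (1 + c • Z)) = (1 - Z * Z) * (1 - c ^ 2 • (Z * Z)) := by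
  have h : (1 - c • Z) * (1 + Z) = (1 + Z) * (1 - c • Z) :=
    diag_commute (sub_mem (one_mem _) (Subalgebra.smul_mem _ hZ _)) (add_mem (one_mem _) hZ)
  have h₁ : (1 - Z) * (1 + Z) = 1 - Z * Z := by noncomm_ring
  have h₂ : (1 - c • Z) * (1 + c • Z) = 1 - c ^ 2 • (Z * Z) := by
    rw [sub_mul, mul_add, mul_add, smul_mul_smul_comm, ← sq c, one_mul, one_mul,
      mul_one]
    abel
  rw [mul_assoc, ← mul_assoc (1 - c • Z), h, mul_assoc (1 + Z), ← mul_assoc, h₁, h₂]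

section Limits

variable [CharZero k]

theorem upperProd_step (hq : q ≠ 0) (hq' : ∀ n : ℕ, 0 < n → q ^ n ≠ 1) (n : ℕ) :
    twist (q ^ 4) (q ^ 2) (q⁻¹ ^ 2) (upperProd q s₁ s₂ n) *
        (1 + q • mono q s₁ s₂ (n + 2) (n + 1) + mono q s₁ s₂ 1 1) =
      (1 + q • mono q s₁ s₂ 1 0 + mono q s₁ s₂ 1 1) * upperProd q s₁ s₂ n := by
  have key := fun m => Psi_upper_step hq (pow_ne_inv_pow hq hq')
    (mono_mem_fil (q := q) (s₁ := s₁) (s₂ := s₂) (a := m + 1) (b := m) (n := 1) (by omega))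
    (mono_upper_mul_diag hq m) (mono_diag_mul_upper m)
  induction n with
  | zero =>
    rw [upperProd, twist_Psi, twist_mono_upper hq 0]
    exact key 0
  | succ n ih =>
    rw [upperProd, map_mul, twist_Psi, twist_mono_upper hq (n + 1), mul_assoc]
    erw [key (n + 1)]
    rw [← mul_assoc, ih, mul_assoc]

theorem lowerProd_step (hq : q ≠ 0) (hq' : ∀ n : ℕ, 0 < n → q ^ n ≠ 1) (n : ℕ) :
    twist (q ^ 4) (q ^ 2) (q⁻¹ ^ 2) (lowerProd q s₁ s₂ n) *
        (1 + q⁻¹ • mono q s₁ s₂ 0 1 + mono q s₁ s₂ 1 1) =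
      (1 + q⁻¹ • mono q s₁ s₂ (n + 1) (n + 2) + mono q s₁ s₂ 1 1) * lowerProd q s₁ s₂ n := by
  have key := fun m => Psi_lower_step hq (pow_ne_inv_pow hq hq')
    (mono_mem_fil (q := q) (s₁ := s₁) (s₂ := s₂) (a := m) (b := m + 1) (n := 1) (by omega))
    (mono_diag_mul_lower hq m) (mono_lower_mul_diag m)
  induction n with
  | zero =>
    rw [lowerProd, twist_Psi, twist_mono_lower hq 0]
    exact key 0
  | succ n ih =>
    rw [lowerProd, map_mul, twist_Psi, twist_mono_lower hq (n + 1), mul_assoc, ih, ← mul_assoc]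
    erw [key (n + 1)]
    rw [mul_assoc]

theorem upper_lim_eq (hq : q ≠ 0) (hq' : ∀ n : ℕ, 0 < n → q ^ n ≠ 1) :
    twist (q ^ 4) (q ^ 2) (q⁻¹ ^ 2) (lim (upperProd q s₁ s₂)) * (1 + mono q s₁ s₂ 1 1) =
      (1 + q • mono q s₁ s₂ 1 0 + mono q s₁ s₂ 1 1) * lim (upperProd q s₁ s₂) := by
  refine eq_of_sub_mem_fil fun n => fil_anti n.le_succ ?_
  have h := sub_lim_mem_fil (upperProd_succ_sub (q := q) (s₁ := s₁) (s₂ := s₂)) n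
  have h₁ := twist_mem_fil (q ^ 2) (q⁻¹ ^ 2) h
  rw [map_sub] at h₁
  have h₂ : (1 + q • mono q s₁ s₂ (n + 2) (n + 1) + mono q s₁ s₂ 1 1) -
      (1 + mono q s₁ s₂ 1 1) ∈ fil (q ^ 4) (n + 1) := by
    rw [add_right_comm]
    exact add_smul_mem_fil (mono_mem_fil (by omega)) _ _
  have h₃ := mul_sub_mul_mem_fil h₁ h₂
  have h₄ := mul_mem_fil_left (1 + q • mono q s₁ s₂ 1 0 + mono q s₁ s₂ 1 1) h
  rw [mul_sub, ← upperProd_step hq hq'] at h₄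
  simpa using sub_mem h₄ h₃

theorem lower_lim_eq (hq : q ≠ 0) (hq' : ∀ n : ℕ, 0 < n → q ^ n ≠ 1) :
    twist (q ^ 4) (q ^ 2) (q⁻¹ ^ 2) (lim (lowerProd q s₁ s₂)) *
        (1 + q⁻¹ • mono q s₁ s₂ 0 1 + mono q s₁ s₂ 1 1) =
      (1 + mono q s₁ s₂ 1 1) * lim (lowerProd q s₁ s₂) := by
  refine eq_of_sub_mem_fil fun n => fil_anti n.le_succ ?_
  have h := sub_lim_mem_fil (lowerProd_succ_sub (q := q) (s₁ := s₁) (s₂ := s₂)) n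
  have h₁ := twist_mem_fil (q ^ 2) (q⁻¹ ^ 2) h
  rw [map_sub] at h₁
  have h₂ : (1 + q⁻¹ • mono q s₁ s₂ (n + 1) (n + 2) + mono q s₁ s₂ 1 1) -
      (1 + mono q s₁ s₂ 1 1) ∈ fil (q ^ 4) (n + 1) := by
    rw [add_right_comm]
    exact add_smul_mem_fil (mono_mem_fil (by omega)) _ _
  have h₃ := mul_sub_mul_mem_fil h₂ h
  have h₄ := mul_mem_fil_right (1 + q⁻¹ • mono q s₁ s₂ 0 1 + mono q s₁ s₂ 1 1) h₁
  rw [sub_mul, lowerProd_step hq hq'] at h₄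
  simpa using sub_mem h₃ h₄

theorem initial_eq (hq : q ≠ 0) (hq' : ∀ n : ℕ, 0 < n → q ^ n ≠ 1) :
    twist (q ^ 4) (q ^ 2) (q⁻¹ ^ 2) (Psi q (mono q s₁ s₂ 0 1) * Psi q (mono q s₁ s₂ 1 0)) *
        (1 + q⁻¹ • mono q s₁ s₂ 0 1 + mono q s₁ s₂ 1 1) =
      (1 + q • mono q s₁ s₂ 1 0 + mono q s₁ s₂ 1 1) *
        (Psi q (mono q s₁ s₂ 0 1) * Psi q (mono q s₁ s₂ 1 0)) := by
  have hVW : mono q s₁ s₂ 1 0 * mono q s₁ s₂ 0 1 = q⁻¹ ^ 2 • mono q s₁ s₂ 1 1 :=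
    mono_mul_mono 1 0 0 1 (by field_simp; ring)
  have hWV : mono q s₁ s₂ 0 1 * mono q s₁ s₂ 1 0 = q ^ 2 • mono q s₁ s₂ 1 1 :=
    mono_mul_mono 0 1 1 0 (by ring)
  have h₁ := Psi_upper_step hq (pow_ne_inv_pow hq hq') (V := mono q s₁ s₂ 1 0)
    (V' := q⁻¹ • mono q s₁ s₂ 1 1) (D := q⁻¹ • mono q s₁ s₂ 0 1) (mono_mem_fil (by omega))
    (by rw [mul_smul_comm, hVW, smul_comm]) (by rw [smul_mul_assoc, hWV, smul_comm])
  have h₂ := Psi_lower_step hq (pow_ne_inv_pow hq hq') (W := mono q s₁ s₂ 0 1)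
    (W' := q • mono q s₁ s₂ 1 1) (D := q • mono q s₁ s₂ 1 0) (mono_mem_fil (by omega))
    (by rw [smul_mul_assoc, hVW, smul_comm]) (by rw [mul_smul_comm, hWV, smul_comm])
  rw [smul_smul, mul_inv_cancel₀ hq, one_smul, add_right_comm] at h₁
  rw [smul_smul, inv_mul_cancel₀ hq, one_smul, add_right_comm] at h₂
  rw [map_mul, twist_Psi, twist_Psi, twist_mono_lower hq 0, twist_mono_upper hq 0, mul_assoc]
  erw [h₁]
  rw [← mul_assoc]
  erw [h₂]
  rw [mul_assoc, add_right_comm 1 (mono q s₁ s₂ 1 1)]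

theorem initial_shift (hq : q ≠ 0) (hq' : ∀ n : ℕ, 0 < n → q ^ n ≠ 1) :
    Psi q (mono q s₁ s₂ 0 1) * Psi q (mono q s₁ s₂ 1 0) =
      (1 + q⁻¹ • mono q s₁ s₂ 0 1) *
        twist (q ^ 4) 1 (q⁻¹ ^ 2) (Psi q (mono q s₁ s₂ 0 1) * Psi q (mono q s₁ s₂ 1 0)) := by
  have h := Psi_smul (pow_ne_inv_pow hq hq') (Z := q⁻¹ • mono q s₁ s₂ 0 1)
    (Submodule.smul_mem _ _ (mono_mem_fil (by omega)))
  rw [smul_smul, mul_inv_cancel₀ hq, one_smul, smul_smul, ← sq] at h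
  rw [map_mul, twist_Psi, twist_Psi, twist_mono, twist_mono, one_pow, one_pow, pow_zero, pow_one,
    one_mul, one_mul, one_smul, ← mul_assoc, ← h]

theorem diagFactor_shift (hq : q ≠ 0) (hq' : ∀ n : ℕ, 0 < n → q ^ n ≠ 1) {n : ℕ} (hn : 0 < n) :
    twist (q ^ 4) (q ^ 4) (q⁻¹ ^ 2) (diagFactor q s₁ s₂ n) =
      (1 + mono q s₁ s₂ n n) * (1 + (q ^ n) ^ 2 • mono q s₁ s₂ n n) * diagFactor q s₁ s₂ n := by
  have hw : q ^ n ≠ 0 := pow_ne_zero n hq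
  have h := Psi_mul_Psi_shift hw (Z := mono q s₁ s₂ n n) (fun m hm => by
    rw [← inv_pow, ← pow_mul, ← pow_mul]
    exact pow_ne_inv_pow hq hq' _ (Nat.mul_pos hn hm)) (mono_mem_fil (by omega))
  rw [← inv_pow] at h
  rw [diagFactor, ← h, map_mul, twist_Psi, twist_Psi, map_smul, map_smul, twist_mono, smul_smul,
    smul_smul]
  have e₁ : q⁻¹ ^ n * ((q ^ 4) ^ n * (q⁻¹ ^ 2) ^ n) = q ^ n := by
    rw [← mul_pow, ← mul_pow]
    congr 1
    field_simp
  have e₂ : q ^ n * ((q ^ 4) ^ n * (q⁻¹ ^ 2) ^ n) = (q ^ n) ^ 3 := by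
    rw [← mul_pow, ← mul_pow, ← pow_mul, mul_comm n 3, pow_mul]
    congr 1
    field_simp
  rw [e₁, e₂]

theorem diagProd_shift (hq : q ≠ 0) (hq' : ∀ n : ℕ, 0 < n → q ^ n ≠ 1) (n : ℕ) :
    (1 - mono q s₁ s₂ 1 1) * (1 - q ^ 2 • mono q s₁ s₂ 1 1) *
        twist (q ^ 4) (q ^ 4) (q⁻¹ ^ 2) (diagProd q s₁ s₂ n) =
      (1 - mono q s₁ s₂ (2 ^ (n + 1)) (2 ^ (n + 1))) *
        (1 - (q ^ 2 ^ (n + 1)) ^ 2 • mono q s₁ s₂ (2 ^ (n + 1)) (2 ^ (n + 1))) *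
        diagProd q s₁ s₂ n := by
  have hmem : ∀ m, mono q s₁ s₂ m m ∈ supported (q ^ 4) diagCone :=
    fun m => mono_mem_supported (mem_diagCone.mpr rfl)
  have key : ∀ m, (1 - mono q s₁ s₂ m m) * (1 - (q ^ m) ^ 2 • mono q s₁ s₂ m m) *
      ((1 + mono q s₁ s₂ m m) * (1 + (q ^ m) ^ 2 • mono q s₁ s₂ m m)) =
      (1 - mono q s₁ s₂ (m * 2) (m * 2)) *
        (1 - (q ^ (m * 2)) ^ 2 • mono q s₁ s₂ (m * 2) (m * 2)) := fun m => by
    rw [one_sub_mul_one_add (hmem m), ← mono_one_pow m, ← mono_one_pow (m * 2), ← pow_add,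
      ← mul_two, pow_mul q m 2]
  induction n with
  | zero =>
    rw [diagProd, diagFactor_shift hq hq' one_pos, ← mul_assoc]
    have := key 1
    rw [pow_one q, one_mul] at this
    rw [pow_one q, this]
    rfl
  | succ n ih =>
    have hc : diagProd q s₁ s₂ n * ((1 + mono q s₁ s₂ (2 ^ (n + 1)) (2 ^ (n + 1))) *
        (1 + (q ^ 2 ^ (n + 1)) ^ 2 • mono q s₁ s₂ (2 ^ (n + 1)) (2 ^ (n + 1)))) =
        ((1 + mono q s₁ s₂ (2 ^ (n + 1)) (2 ^ (n + 1))) *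
        (1 + (q ^ 2 ^ (n + 1)) ^ 2 • mono q s₁ s₂ (2 ^ (n + 1)) (2 ^ (n + 1)))) *
        diagProd q s₁ s₂ n :=
      diag_commute (diagProd_mem n) (mul_mem (add_mem (one_mem _) (hmem _))
        (add_mem (one_mem _) (Subalgebra.smul_mem _ (hmem _) _)))
    rw [diagProd, map_mul, diagFactor_shift hq hq' (by positivity), ← mul_assoc, ih,
      mul_assoc _ (diagProd q s₁ s₂ n), ← mul_assoc (diagProd q s₁ s₂ n), hc, ← mul_assoc,
      ← mul_assoc, key, ← pow_succ, mul_assoc]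

theorem diag_lim_eq (hq : q ≠ 0) (hq' : ∀ n : ℕ, 0 < n → q ^ n ≠ 1) :
    (1 - mono q s₁ s₂ 1 1) * (1 - q ^ 2 • mono q s₁ s₂ 1 1) *
        twist (q ^ 4) (q ^ 4) (q⁻¹ ^ 2) (lim (diagProd q s₁ s₂)) = lim (diagProd q s₁ s₂) := by
  refine eq_of_sub_mem_fil fun n => fil_anti n.le_succ ?_
  have h := sub_lim_mem_fil (diagProd_succ_sub (q := q) (s₁ := s₁) (s₂ := s₂)) n
  have h₁ := twist_mem_fil (q ^ 4) (q⁻¹ ^ 2) h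
  rw [map_sub] at h₁
  have h₂ := mul_mem_fil_left ((1 - mono q s₁ s₂ 1 1) * (1 - q ^ 2 • mono q s₁ s₂ 1 1)) h₁
  rw [mul_sub, diagProd_shift hq hq'] at h₂
  have hlt : n + 1 < 2 ^ (n + 1) := Nat.lt_two_pow_self
  have hm : mono q s₁ s₂ (2 ^ (n + 1)) (2 ^ (n + 1)) ∈ fil (q ^ 4) (n + 1) :=
    mono_mem_fil (by omega)
  have h₃ := mul_sub_self_mem_fil' (diagProd q s₁ s₂ n) (mul_sub_one_mem_fil
    (F := 1 - mono q s₁ s₂ (2 ^ (n + 1)) (2 ^ (n + 1)))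
    (G := 1 - (q ^ 2 ^ (n + 1)) ^ 2 • mono q s₁ s₂ (2 ^ (n + 1)) (2 ^ (n + 1)))
    (by simpa using hm) (by simpa using Submodule.smul_mem _ _ hm))
  simpa using sub_mem (add_mem h₃ h) h₂

end Limits
end Affine

section Factorization

variable {q s₁ s₂ : k}

theorem superdiag_mul_mono (hq : q ≠ 0) (F : Series (q ^ 4)) :
    superdiag F * mono q s₁ s₂ 1 1 = q ^ 4 • (mono q s₁ s₂ 1 1 * superdiag F) := by
  have ht : q ^ 4 ≠ 0 := pow_ne_zero 4 hq
  rw [mono, single_mul ht, ← smul_mul_assoc]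
  congr 1
  ext p
  rw [map_smul, coeff_twist, coeff_superdiag, smul_eq_mul]
  split_ifs with h
  · rw [h, pow_one, pow_one, pow_succ (q ^ 4)⁻¹, ← mul_assoc _ _ (q ^ 4)⁻¹, ← mul_pow,
      mul_inv_cancel₀ ht, one_pow, one_mul, ← mul_assoc, mul_inv_cancel₀ ht, one_mul]
  · simp

/-- The first superdiagonal of a solution of the lower `q`-difference equation. -/
theorem superdiag_of_lower_eq (hq : q ≠ 0) (hq' : ∀ n : ℕ, 0 < n → q ^ n ≠ 1)
    {R : Series (q ^ 4)} (hR : R ∈ supported (q ^ 4) lowerCone) (hR' : R - 1 ∈ fil (q ^ 4) 1)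
    (h : twist (q ^ 4) (q ^ 2) (q⁻¹ ^ 2) R *
      (1 + q⁻¹ • mono q s₁ s₂ 0 1 + mono q s₁ s₂ 1 1) = (1 + mono q s₁ s₂ 1 1) * R) :
    (1 - q ^ 2 • mono q s₁ s₂ 1 1) * superdiag R = (q - q⁻¹)⁻¹ • mono q s₁ s₂ 0 1 := by
  have hZ : mono q s₁ s₂ 1 1 ∈ supported (q ^ 4) diagCone :=
    mono_mem_supported (mem_diagCone.mpr rfl)
  have hR₁ : twist (q ^ 4) (q ^ 2) (q⁻¹ ^ 2) R - 1 ∈ fil (q ^ 4) 1 := by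
    have := twist_mem_fil (q ^ 2) (q⁻¹ ^ 2) hR'
    rwa [map_sub, map_one] at this
  have h₁ := congrArg superdiag h
  rw [add_right_comm, mul_add, mul_smul_comm, map_add, map_smul,
    superdiag_mul_diag (add_mem (one_mem _) hZ), superdiag_diag_mul (add_mem (one_mem _) hZ),
    superdiag_twist] at h₁
  have h₂ : superdiag (twist (q ^ 4) (q ^ 2) (q⁻¹ ^ 2) R * mono q s₁ s₂ 0 1) = mono q s₁ s₂ 0 1 :=
    superdiag_lower_mul_single (twist_mem_supported _ _ hR) hR₁ _
  have h₃ : twist (q ^ 4) (q ^ 2) (q⁻¹ ^ 2) (superdiag R) = q⁻¹ ^ 2 • superdiag R := by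
    ext p
    rw [map_smul, coeff_twist, coeff_superdiag, smul_eq_mul]
    split_ifs with hp
    · rw [hp, pow_succ (q⁻¹ ^ 2), ← mul_assoc _ _ (q⁻¹ ^ 2), ← mul_pow, ← mul_pow,
        mul_inv_cancel₀ hq, one_pow, one_pow, one_mul]
    · simp
  rw [h₂, h₃, smul_mul_assoc, mul_add, mul_one, superdiag_mul_mono hq, add_mul, one_mul,
    smul_add, smul_smul] at h₁
  have e : q⁻¹ ^ 2 * q ^ 4 = q ^ 2 := by field_simp
  rw [e] at h₁
  have hne : q - q⁻¹ ≠ 0 :=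
    sub_ne_zero.mpr (by simpa using pow_ne_inv_pow hq hq' 1 one_pos)
  rw [sub_mul, one_mul, smul_mul_assoc, eq_inv_smul_iff₀ hne]
  have h₄ : mono q s₁ s₂ 0 1 = q • (superdiag R + mono q s₁ s₂ 1 1 * superdiag R -
      (q⁻¹ ^ 2 • superdiag R + q ^ 2 • (mono q s₁ s₂ 1 1 * superdiag R))) := by
    rw [← h₁, add_sub_cancel_left, smul_smul, mul_inv_cancel₀ hq, one_smul]
  rw [h₄]
  have e₁ : q * q⁻¹ ^ 2 = q⁻¹ := by field_simp
  simp only [smul_sub, smul_add, sub_smul, smul_smul, e₁]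
  have e₂ : (q - q⁻¹) * q ^ 2 = q * q ^ 2 - q := by field_simp
  rw [e₂, sub_smul]
  abel

theorem superdiag_quotient (hq : q ≠ 0) (hq' : ∀ n : ℕ, 0 < n → q ^ n ≠ 1)
    {R : Series (q ^ 4)} (hR : R ∈ supported (q ^ 4) lowerCone) (hR' : R - 1 ∈ fil (q ^ 4) 1)
    (h : twist (q ^ 4) (q ^ 2) (q⁻¹ ^ 2) R *
      (1 + q⁻¹ • mono q s₁ s₂ 0 1 + mono q s₁ s₂ 1 1) = (1 + mono q s₁ s₂ 1 1) * R)
    {R' : Series (q ^ 4)} (hS : R' ∈ supported (q ^ 4) lowerCone) (hS' : R' - 1 ∈ fil (q ^ 4) 1)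
    (hRR' : R * R' = 1) :
    (1 - mono q s₁ s₂ 1 1) * (1 - q ^ 2 • mono q s₁ s₂ 1 1) *
      superdiag (R * twist (q ^ 4) 1 (q⁻¹ ^ 2) R') = q⁻¹ • mono q s₁ s₂ 0 1 := by
  have hZ : mono q s₁ s₂ 1 1 ∈ supported (q ^ 4) diagCone :=
    mono_mem_supported (mem_diagCone.mpr rfl)
  have h₁ := superdiag_of_lower_eq hq hq' hR hR' h
  have h₂ := superdiag_mul_lower hR hS hR' hS'
  rw [hRR', superdiag_one] at h₂
  have h₃ := congrArg (twist (q ^ 4) 1 (q⁻¹ ^ 2)) h₁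
  rw [map_mul, map_sub, map_one, map_smul, map_smul, twist_mono, twist_mono, one_pow, one_pow,
    pow_one, one_mul, smul_smul, ← mul_pow, mul_inv_cancel₀ hq, one_pow, one_smul] at h₃
  have hT : twist (q ^ 4) 1 (q⁻¹ ^ 2) R' - 1 ∈ fil (q ^ 4) 1 := by
    have := twist_mem_fil 1 (q⁻¹ ^ 2) hS'
    rwa [map_sub, map_one] at this
  have hc : (1 - mono q s₁ s₂ 1 1) * (1 - q ^ 2 • mono q s₁ s₂ 1 1) =
      (1 - q ^ 2 • mono q s₁ s₂ 1 1) * (1 - mono q s₁ s₂ 1 1) :=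
    diag_commute (sub_mem (one_mem _) hZ) (sub_mem (one_mem _) (Subalgebra.smul_mem _ hZ _))
  rw [superdiag_mul_lower hR (twist_mem_supported _ _ hS) hR' hT, superdiag_twist,
    eq_neg_of_add_eq_zero_right h₂.symm, map_neg, mul_add, mul_assoc, h₁, hc, mul_assoc, mul_neg,
    h₃]
  have hne : q - q⁻¹ ≠ 0 :=
    sub_ne_zero.mpr (by simpa using pow_ne_inv_pow hq hq' 1 one_pos)
  have e : q⁻¹ = (q - q⁻¹)⁻¹ - (q - q⁻¹)⁻¹ * q⁻¹ ^ 2 := by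
    rw [eq_sub_iff_add_eq, ← mul_right_inj' hne, mul_add, mul_inv_cancel_left₀ hne,
      mul_inv_cancel₀ hne]
    field_simp
    ring
  have e₁ : q ^ 2 * q⁻¹ ^ 2 = 1 := by rw [← mul_pow, mul_inv_cancel₀ hq, one_pow]
  rw [mul_neg, sub_mul, sub_mul, one_mul, one_mul, mul_smul_comm, smul_mul_assoc, mul_smul_comm,
    mul_smul_comm, smul_comm (q ^ 2), smul_smul (q ^ 2), e₁, one_smul, e, sub_smul, mul_smul, ← e]
  abel

theorem mul_eq_mul_of_mul_eq_mul {M : Type*} [Monoid M] {a a' b b' x y : M} (ha : a' * a = 1)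
    (hb : b * b' = 1) (h : a * x = y * b) : x * b' = a' * y := by
  rw [← one_mul x, ← ha, mul_assoc a', h, mul_assoc, mul_assoc, hb, mul_one]

variable [CharZero k]

/-- The factorization of the product of two quantum dilogarithms into factors of slope less than,
equal to and greater than one. -/
theorem initial_factorization (hq : q ≠ 0) (hq' : ∀ n : ℕ, 0 < n → q ^ n ≠ 1)
    (hs₂ : s₂ ≠ 0) :
    Psi q (mono q s₁ s₂ 0 1) * Psi q (mono q s₁ s₂ 1 0) =
      lim (upperProd q s₁ s₂) * (lim (diagProd q s₁ s₂) * lim (lowerProd q s₁ s₂)) := by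
  have ht : q ^ 4 ≠ 0 := pow_ne_zero 4 hq
  have hZ : mono q s₁ s₂ 1 1 ∈ supported (q ^ 4) diagCone :=
    mono_mem_supported (mem_diagCone.mpr rfl)
  have hZ' : mono q s₁ s₂ 1 1 ∈ fil (q ^ 4) 1 := mono_mem_fil (by omega)
  have hPsi : ∀ a b : ℕ, 1 ≤ a + b → Psi q (mono q s₁ s₂ a b) - 1 ∈ fil (q ^ 4) 1 :=
    fun a b h => Psi_sub_one_mem_fil q (mono_mem_fil h)
  have hP' : lim (upperProd q s₁ s₂) - 1 ∈ fil (q ^ 4) 1 :=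
    lim_sub_one upperProd_succ_sub (hPsi 1 0 le_rfl)
  have hQ' : lim (lowerProd q s₁ s₂) - 1 ∈ fil (q ^ 4) 1 :=
    lim_sub_one lowerProd_succ_sub (hPsi 0 1 le_rfl)
  have hM' : lim (diagProd q s₁ s₂) - 1 ∈ fil (q ^ 4) 1 :=
    lim_sub_one diagProd_succ_sub (diagFactor_sub_one le_rfl)
  have hP := lim_mem_supported (upperProd_mem (q := q) (s₁ := s₁) (s₂ := s₂))
  have hQ := lim_mem_supported (lowerProd_mem (q := q) (s₁ := s₁) (s₂ := s₂))
  have hM := lim_mem_supported (diagProd_mem (q := q) (s₁ := s₁) (s₂ := s₂))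
  have hP_eq := upper_lim_eq (s₁ := s₁) (s₂ := s₂) hq hq'
  have hQ_eq := lower_lim_eq (s₁ := s₁) (s₂ := s₂) hq hq'
  have hM_eq := diag_lim_eq (s₁ := s₁) (s₂ := s₂) hq hq'
  have hF_eq := initial_eq (s₁ := s₁) (s₂ := s₂) hq hq'
  have hF_shift := initial_shift (s₁ := s₁) (s₂ := s₂) hq hq'
  have hF' := mul_sub_one_mem_fil (hPsi 0 1 le_rfl) (hPsi 1 0 le_rfl)
  generalize Psi q (mono q s₁ s₂ 0 1) * Psi q (mono q s₁ s₂ 1 0) = F at *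
  generalize lim (upperProd q s₁ s₂) = P at *
  generalize lim (lowerProd q s₁ s₂) = Q at *
  generalize lim (diagProd q s₁ s₂) = M at *
  obtain ⟨U, hU, hU', hPU, hUP⟩ := exists_inverse hP' hP
  obtain ⟨V, hV, hV', hQV, hVQ⟩ := exists_inverse hQ' hQ
  have hF_fac : F = P * (U * F * V) * Q := by
    rw [mul_assoc, mul_assoc (U * F), hVQ, mul_one, ← mul_assoc, hPU, one_mul]
  have hD' : U * F * V - 1 ∈ fil (q ^ 4) 1 :=
    mul_sub_one_mem_fil (mul_sub_one_mem_fil hU' hF') hV'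
  have hD : U * F * V ∈ supported (q ^ 4) diagCone := by
    refine mem_diag_of_twist (c := q ^ 2) (d := q⁻¹ ^ 2)
      (by rw [← mul_pow, mul_inv_cancel₀ hq, one_pow])
      (fun n hn => by rw [← pow_mul]; exact hq' _ (by omega)) hZ hZ' ?_
    set ρ := twist (q ^ 4) (q ^ 2) (q⁻¹ ^ 2)
    set Z := mono q s₁ s₂ 1 1
    have hρU : ρ U * ρ P = 1 := by rw [← map_mul, hUP, map_one]
    have hρV : ρ V * ρ Q = 1 := by rw [← map_mul, hVQ, map_one]
    have h₁ : (1 + q⁻¹ • mono q s₁ s₂ 0 1 + Z) * V = ρ V * (1 + Z) := 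
      mul_eq_mul_of_mul_eq_mul hρV hQV hQ_eq
    have h₂ : ρ U * (1 + q • mono q s₁ s₂ 1 0 + Z) = (1 + Z) * U := 
      (mul_eq_mul_of_mul_eq_mul hρU hPU hP_eq).symm
    rw [map_mul, map_mul, mul_assoc, ← h₁, ← mul_assoc, mul_assoc (ρ U), hF_eq, ← mul_assoc, h₂,
      mul_assoc (1 + Z), mul_assoc (1 + Z)]
  generalize U * F * V = D at *
  set A := (1 - mono q s₁ s₂ 1 1) * (1 - q ^ 2 • mono q s₁ s₂ 1 1) with hA
  set σ := twist (q ^ 4) 1 (q⁻¹ ^ 2)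
  have hσ : σ Q * σ V = 1 := by rw [← map_mul, hQV, map_one]
  have hσP : σ P - 1 ∈ fil (q ^ 4) 1 := by
    have := twist_mem_fil 1 (q⁻¹ ^ 2) hP'
    rwa [map_sub, map_one] at this
  have hshift : D * (Q * σ V) = U * (1 + q⁻¹ • mono q s₁ s₂ 0 1) * σ P * σ D := by
    have h := hF_shift
    rw [hF_fac, map_mul, map_mul] at h
    have h₁ := congrArg (fun G => U * G * σ V) h
    rw [← mul_assoc U, ← mul_assoc U, hUP, one_mul, mul_assoc D] at h₁
    rw [h₁]
    simp only [mul_assoc, hσ, mul_one]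
  have hsd : D * superdiag (Q * σ V) = q⁻¹ • (mono q s₁ s₂ 0 1 * σ D) := by
    rw [← superdiag_diag_mul hD, hshift, superdiag_mul_diag (twist_mem_supported _ _ hD), mul_add,
      mul_one, add_mul, map_add, superdiag_upper (mul_mem hU (twist_mem_supported _ _ hP)),
      zero_add, mul_smul_comm, smul_mul_assoc, map_smul, smul_mul_assoc]
    congr 2
    exact superdiag_upper_mul_single_mul_upper hU (twist_mem_supported _ _ hP) hU' hσP _
  have hquot := superdiag_quotient hq hq' hQ hQ' hQ_eq hV hV' hQV
  have hAmem : A ∈ supported (q ^ 4) diagCone :=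
    mul_mem (sub_mem (one_mem _) hZ) (sub_mem (one_mem _) (Subalgebra.smul_mem _ hZ _))
  have hA' : A - 1 ∈ fil (q ^ 4) 1 :=
    mul_sub_one_mem_fil (by simpa using hZ') (by simpa using Submodule.smul_mem _ _ hZ')
  have hD_eq : A * twist (q ^ 4) (q ^ 4) (q⁻¹ ^ 2) D = D := by
    have h := congrArg (A * ·) hsd
    rw [← mul_assoc, diag_commute hAmem hD, mul_assoc, hquot, mul_smul_comm, mul_smul_comm] at h
    have h₁ := smul_right_injective _ (inv_ne_zero hq) h
    rw [mono, single_mul ht, twist_twist, pow_one (q ^ 4), mul_one (q ^ 4), pow_zero (q ^ 4)⁻¹,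
      one_mul (q⁻¹ ^ 2), ← mul_assoc] at h₁
    exact (mul_single_cancel ht (by simpa using hs₂) h₁).symm
  have hDM : D = M := diag_eq_of_twist (c := q ^ 4) (d := q⁻¹ ^ 2) (fun n hn => by
    have e : q ^ 4 * q⁻¹ ^ 2 = q ^ 2 := by field_simp
    rw [e, ← pow_mul]
    exact hq' _ (by omega)) hD hM hD' hM' hA' hD_eq hM_eq
  rw [hF_fac, hDM, mul_assoc]

theorem ordered_product_sub_mem_fil (hq : q ≠ 0) (hq' : ∀ n : ℕ, 0 < n → q ^ n ≠ 1)
    (hs₂ : s₂ ≠ 0) (n : ℕ) :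
    upperProd q s₁ s₂ n * (diagProd q s₁ s₂ n * lowerProd q s₁ s₂ n) -
      Psi q (mono q s₁ s₂ 0 1) * Psi q (mono q s₁ s₂ 1 0) ∈ fil (q ^ 4) (n + 1) := by
  rw [initial_factorization hq hq' hs₂]
  exact mul_sub_mul_mem_fil (sub_lim_mem_fil upperProd_succ_sub n)
    (mul_sub_mul_mem_fil (sub_lim_mem_fil diagProd_succ_sub n)
      (sub_lim_mem_fil lowerProd_succ_sub n))

end Factorization

end Series

open Series

theorem v_ne_zero : v ≠ 0 := RatFunc.X_ne_zero

theorem v_pow_ne_one (n : ℕ) (hn : 0 < n) : v ^ n ≠ 1 := by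
  intro h
  have h₁ : algebraMap (Polynomial ℚ) (RatFunc ℚ) (Polynomial.X ^ n) =
      algebraMap (Polynomial ℚ) (RatFunc ℚ) 1 := by
    rw [map_pow, RatFunc.algebraMap_X, map_one]
    exact h
  have h₂ := congrArg Polynomial.natDegree (RatFunc.algebraMap_injective ℚ h₁)
  rw [Polynomial.natDegree_X_pow, Polynomial.natDegree_one] at h₂
  omega

/-- An element of the completed quantum plane as a member of the ring `Series`. -/
def toSeries (e : ℕ) (F : QP) : Series ((v ^ e) ^ 4) := ofCoeff _ F

theorem coeff_toSeries (e : ℕ) (F : QP) (p : ℕ × ℕ) : coeff p (toSeries e F) = F p := rfl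

theorem toSeries_qmul (e : ℕ) (F G : QP) :
    toSeries e (qmul (2 * e) F G) = toSeries e F * toSeries e G := by
  ext p
  rw [coeff_mul_range, coeff_toSeries, qmul]
  refine sum_congr rfl fun a _ => sum_congr rfl fun b _ => ?_
  rw [← pow_mul, ← pow_mul]
  congr 3
  ring

theorem toSeries_qone (e : ℕ) : toSeries e qone = 1 := rfl

theorem toSeries_qpow (e : ℕ) (Z : QP) (n : ℕ) :
    toSeries e (qpow (2 * e) Z n) = toSeries e Z ^ n := by
  induction n with
  | zero => rw [qpow, toSeries_qone, pow_zero (toSeries e Z)]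
  | succ n ih => rw [qpow, toSeries_qmul, ih, pow_succ' (toSeries e Z)]

theorem toSeries_qarg (e : ℕ) (w : K) {Z : QP} :
    toSeries e (qarg (2 * e) w Z) = subst (toSeries e Z) (dilogArg w) := by
  ext p
  have h₀ : PowerSeries.coeff 0 (dilogArg w) = 0 := by
    rw [PowerSeries.coeff_zero_eq_constantCoeff_apply, constantCoeff_dilogArg]
  rw [subst, coeff_ofCoeff, coeff_toSeries, qarg, sum_range_succ', h₀, zero_mul, add_zero,
    range_eq_Ico, sum_Ico_add' (fun j => PowerSeries.coeff j (dilogArg w) *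
      coeff p (toSeries e Z ^ j)) 0 _ 1, zero_add]
  refine sum_congr rfl fun j _ => ?_
  rw [dilogArg, PowerSeries.coeff_mk, ← toSeries_qpow, coeff_toSeries]

theorem toSeries_qPsi (e : ℕ) (w : K) {Z : QP} (hZ : toSeries e Z ∈ fil ((v ^ e) ^ 4) 1) :
    toSeries e (qPsi (2 * e) w Z) = Psi w (toSeries e Z) := by
  ext p
  rw [Psi, dilog, coeff_subst_expSeries hZ (constantCoeff_dilogArg w), coeff_toSeries, qPsi]
  refine sum_congr rfl fun i _ => ?_
  rw [← toSeries_qarg, ← toSeries_qpow, coeff_toSeries]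

theorem toSeries_foldr (e : ℕ) (l : List QP) :
    toSeries e (l.foldr (qmul (2 * e)) qone) = (l.map (toSeries e)).prod := by
  induction l with
  | nil => rfl
  | cons F l ih => rw [List.foldr_cons, toSeries_qmul, ih, List.map_cons, List.prod_cons]

theorem toSeries_qprodR_zero (e : ℕ) (g : ℕ → QP) :
    toSeries e (qprodR (2 * e) g 0 0) = toSeries e (g 0) := by
  rw [qprodR, toSeries_foldr]
  simp

theorem toSeries_qprodR_succ (e : ℕ) (g : ℕ → QP) (n : ℕ) :
    toSeries e (qprodR (2 * e) g 0 (n + 1)) =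
      toSeries e (qprodR (2 * e) g 0 n) * toSeries e (g (n + 1)) := by
  rw [qprodR, qprodR, toSeries_foldr, toSeries_foldr, Nat.sub_zero, Nat.sub_zero,
    ← List.range_eq_range', ← List.range_eq_range', List.range_succ]
  simp only [List.map_append, List.prod_append, List.map_cons, List.map_nil, List.prod_singleton]

theorem toSeries_qprodL_zero (e : ℕ) (g : ℕ → QP) :
    toSeries e (qprodL (2 * e) g 0 0) = toSeries e (g 0) := by
  rw [qprodL, toSeries_foldr]
  simp

theorem toSeries_qprodL_succ (e : ℕ) (g : ℕ → QP) (n : ℕ) :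
    toSeries e (qprodL (2 * e) g 0 (n + 1)) =
      toSeries e (g (n + 1)) * toSeries e (qprodL (2 * e) g 0 n) := by
  rw [qprodL, qprodL, toSeries_foldr, toSeries_foldr, Nat.sub_zero, Nat.sub_zero,
    ← List.range_eq_range', ← List.range_eq_range', List.range_succ]
  simp only [List.reverse_append, List.map_append, List.prod_append, List.reverse_singleton,
    List.map_cons, List.map_nil, List.prod_singleton]

theorem toSeries_qy (e : ℕ) (β β' γ : ℤ) {δ : ℤ} {m n : ℕ} (h : δ = γ + m * β + n * β') :
    toSeries e (qy (2 * e) δ m n) = v ^ γ • mono (v ^ e) (v ^ β) (v ^ β') m n := by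
  ext p
  rw [coeff_toSeries, qy, map_smul, mono, coeff_single, smul_eq_mul, mul_ite, mul_zero]
  congr 1
  simp only [← zpow_natCast, ← zpow_mul]
  rw [← zpow_add₀ v_ne_zero, ← zpow_add₀ v_ne_zero, ← zpow_add₀ v_ne_zero, h]
  congr 1
  push_cast
  ring

theorem toSeries_qPsi_qy (e : ℕ) (β β' γ : ℤ) (w : K) {δ : ℤ} {m n : ℕ}
    (h : δ = γ + m * β + n * β') (hmn : 1 ≤ m + n) :
    toSeries e (qPsi (2 * e) w (qy (2 * e) δ m n)) =
      Psi w (v ^ γ • mono (v ^ e) (v ^ β) (v ^ β') m n) := by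
  have := toSeries_qy e β β' γ h
  rw [toSeries_qPsi, this]
  rw [this]
  exact Submodule.smul_mem _ _ (mono_mem_fil hmn)

theorem toSeries_upper (e : ℕ) (β β' : ℤ) (n : ℕ) :
    toSeries e (qprodR (2 * e) (fun p => qPsi (2 * e) (v ^ e)
      (qy (2 * e) (((p : ℤ) + 1) * β + (p : ℤ) * β') (p + 1) p)) 0 n) =
      upperProd (v ^ e) (v ^ β) (v ^ β') n := by
  have key : ∀ p : ℕ, toSeries e (qPsi (2 * e) (v ^ e)
      (qy (2 * e) (((p : ℤ) + 1) * β + (p : ℤ) * β') (p + 1) p)) =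
      Psi (v ^ e) (mono (v ^ e) (v ^ β) (v ^ β') (p + 1) p) := fun p => by
    rw [toSeries_qPsi_qy e β β' 0 _ (by push_cast; ring) (by omega), zpow_zero, one_smul]
  induction n with
  | zero => rw [toSeries_qprodR_zero, key, upperProd]
  | succ n ih => rw [toSeries_qprodR_succ, ih, key, upperProd]

theorem toSeries_lower (e : ℕ) (β β' : ℤ) (n : ℕ) :
    toSeries e (qprodL (2 * e) (fun p => qPsi (2 * e) (v ^ e)
      (qy (2 * e) ((p : ℤ) * β + ((p : ℤ) + 1) * β') p (p + 1))) 0 n) =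
      lowerProd (v ^ e) (v ^ β) (v ^ β') n := by
  have key : ∀ p : ℕ, toSeries e (qPsi (2 * e) (v ^ e)
      (qy (2 * e) ((p : ℤ) * β + ((p : ℤ) + 1) * β') p (p + 1))) =
      Psi (v ^ e) (mono (v ^ e) (v ^ β) (v ^ β') p (p + 1)) := fun p => by
    rw [toSeries_qPsi_qy e β β' 0 _ (by push_cast; ring) (by omega), zpow_zero, one_smul]
  induction n with
  | zero => rw [toSeries_qprodL_zero, key, lowerProd]
  | succ n ih => rw [toSeries_qprodL_succ, ih, key, lowerProd]

theorem toSeries_diag (e : ℕ) (β β' : ℤ) (n : ℕ) :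
    toSeries e (qprodR (2 * e) (fun p => qmul (2 * e)
      (qPsi (2 * e) (v ^ (2 ^ p * e))
        (qy (2 * e) ((2 ^ p : ℤ) * (β + β') - (2 ^ p : ℤ) * (e : ℤ)) (2 ^ p) (2 ^ p)))
      (qPsi (2 * e) (v ^ (2 ^ p * e))
        (qy (2 * e) ((2 ^ p : ℤ) * (β + β') + (2 ^ p : ℤ) * (e : ℤ)) (2 ^ p) (2 ^ p)))) 0 n) =
      diagProd (v ^ e) (v ^ β) (v ^ β') n := by
  have key : ∀ p : ℕ, toSeries e (qmul (2 * e)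
      (qPsi (2 * e) (v ^ (2 ^ p * e))
        (qy (2 * e) ((2 ^ p : ℤ) * (β + β') - (2 ^ p : ℤ) * (e : ℤ)) (2 ^ p) (2 ^ p)))
      (qPsi (2 * e) (v ^ (2 ^ p * e))
        (qy (2 * e) ((2 ^ p : ℤ) * (β + β') + (2 ^ p : ℤ) * (e : ℤ)) (2 ^ p) (2 ^ p)))) =
      diagFactor (v ^ e) (v ^ β) (v ^ β') (2 ^ p) := fun p => by
    have hp : 0 < 2 ^ p := by positivity
    have e₁ : v ^ (((2 ^ p * e : ℕ) : ℤ)) = (v ^ e) ^ 2 ^ p := by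
      rw [zpow_natCast, mul_comm, pow_mul]
    rw [toSeries_qmul, toSeries_qPsi_qy e β β' (-((2 ^ p * e : ℕ) : ℤ)) _ (by push_cast; ring)
      (by omega), toSeries_qPsi_qy e β β' ((2 ^ p * e : ℕ) : ℤ) _ (by push_cast; ring)
      (by omega), zpow_neg, e₁, diagFactor, mul_comm (2 ^ p) e, pow_mul, inv_pow]
  induction n with
  | zero =>
    rw [toSeries_qprodR_zero, key, diagProd, pow_zero]
  | succ n ih => rw [toSeries_qprodR_succ, ih, key, diagProd]

end QuantumPlane
/-- Theorem A.4: ordered product expansion of affine type `A₁⁽¹⁾`: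
in `A_{2e}`,
`Ψ_{v^e}(v^{β'}Y₂)·Ψ_{v^e}(v^{β}Y₁)
 = (→∏_{p≥0} Ψ_{v^e}(v^{(p+1)β+pβ'}y^{(p+1,p)}))·
   (∏_{p≥0} Ψ_{v^{2^p e}}(v^{2^p(β+β')−2^p e}y^{(2^p,2^p)})·Ψ_{v^{2^p e}}(v^{2^p(β+β')+2^p e}y^{(2^p,2^p)}))·
   (←∏_{p≥0} Ψ_{v^e}(v^{pβ+(p+1)β'}y^{(p,p+1)}))`,
the right-hand side understood as the coefficientwise limit of the partial ordered products. -/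
theorem theorem_A4 (e : ℕ) (he : 0 < e) (β β' : ℤ) :
    ∀ x, ∀ᶠ N in atTop,
      qmul (2 * e)
        (qprodR (2 * e)
          (fun p => qPsi (2 * e) (v ^ e)
            (qy (2 * e) (((p : ℤ) + 1) * β + (p : ℤ) * β') (p + 1) p)) 0 N)
        (qmul (2 * e)
          (qprodR (2 * e)
            (fun p => qmul (2 * e)
              (qPsi (2 * e) (v ^ (2 ^ p * e))
                (qy (2 * e) ((2 ^ p : ℤ) * (β + β') - (2 ^ p : ℤ) * (e : ℤ)) (2 ^ p) (2 ^ p)))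
              (qPsi (2 * e) (v ^ (2 ^ p * e))
                (qy (2 * e) ((2 ^ p : ℤ) * (β + β') + (2 ^ p : ℤ) * (e : ℤ)) (2 ^ p) (2 ^ p)))) 0 N)
          (qprodL (2 * e)
            (fun p => qPsi (2 * e) (v ^ e)
              (qy (2 * e) ((p : ℤ) * β + ((p : ℤ) + 1) * β') p (p + 1))) 0 N)) x
      = qmul (2 * e) (qPsi (2 * e) (v ^ e) (qy (2 * e) β' 0 1))
          (qPsi (2 * e) (v ^ e) (qy (2 * e) β 1 0)) x := by
  intro x
  filter_upwards [eventually_ge_atTop (x.1 + x.2)] with N hN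
  have hq : v ^ e ≠ 0 := pow_ne_zero e QuantumPlane.v_ne_zero
  have hq' : ∀ n : ℕ, 0 < n → (v ^ e) ^ n ≠ 1 := fun n hn => by
    rw [← pow_mul]
    exact QuantumPlane.v_pow_ne_one _ (Nat.mul_pos he hn)
  have h := QuantumPlane.Series.ordered_product_sub_mem_fil (s₁ := v ^ β) hq hq'
    (zpow_ne_zero β' QuantumPlane.v_ne_zero) N x (by omega)
  rw [← QuantumPlane.toSeries_upper, ← QuantumPlane.toSeries_lower, ← QuantumPlane.toSeries_diag,
    ← one_smul K (QuantumPlane.Series.mono _ _ _ 0 1),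
    ← one_smul K (QuantumPlane.Series.mono _ _ _ 1 0), ← zpow_zero v,
    ← QuantumPlane.toSeries_qPsi_qy e β β' 0 _ (m := 0) (n := 1) (δ := β') (by simp) le_rfl,
    ← QuantumPlane.toSeries_qPsi_qy e β β' 0 _ (m := 1) (n := 0) (δ := β) (by simp) le_rfl,
    ← QuantumPlane.toSeries_qmul, ← QuantumPlane.toSeries_qmul, ← QuantumPlane.toSeries_qmul,
    map_sub, sub_eq_zero] at h
  exact h
end
end

section
/- (Lemma A.5, quantum-plane form.) Let f be a positive integer, β, β' integers, ε ∈ {+1, −1}, and ℓ ≥ 0 an integer. In the completed quantum plane A_{4f} (so Y₂Y₁ = v^{8f}·Y₁Y₂), both of the following identities hold: (i) Ψ_{v^{4f}}(v^{β'}·Y₂) · →∏_{p=0..ℓ} Ψ_{v^{2f}}(v^{β+pβ'+2pεf}·y^{(1,p)}) = Ψ_{v^{2f}}(v^{β}·Y₁) · (→∏_{p=1..ℓ} [Ψ_{v^{4f}}(v^{2β+(2p−1)β'+4(p−1)εf}·y^{(2,2p−1)}) · Ψ_{v^{f}}(v^{β+pβ'+(2p−1)εf}·y^{(1,p)})]) ·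 Ψ_{v^{4f}}(v^{2β+(2ℓ+1)β'+4ℓεf}·y^{(2,2ℓ+1)}) · Ψ_{v^{2f}}(v^{β+(ℓ+1)β'+2ℓεf}·y^{(1,ℓ+1)}) · Ψ_{v^{4f}}(v^{β'}·Y₂); and (ii) (←∏_{p=0..ℓ} Ψ_{v^{2f}}(v^{pβ+β'+2pεf}·y^{(p,1)})) · Ψ_{v^{4f}}(v^{β}·Y₁) = Ψ_{v^{4f}}(v^{β}·Y₁) · Ψ_{v^{2f}}(v^{(ℓ+1)β+β'+2ℓεf}·y^{(ℓ+1,1)}) · Ψ_{v^{4f}}(v^{(2ℓ+1)β+2β'+4ℓεf}·y^{(2ℓ+1,2)}) · (←∏_{p=1..ℓ} [Ψ_{v^{f}}(v^{pβ+β'+(2p−1)εf}·y^{(p,1)}) · Ψ_{v^{4f}}(v^{(2p−1)β+2β'+4(p−1)εf}·y^{(2p−1,2)})]) · Ψ_{v^{2f}}(v^{β'}·Y₂). -/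
noncomputable section

open Filter

namespace PowerSeries

/-- A solution of `F' = F * D` is determined by its constant term. -/
theorem eq_of_derivative_eq_mul {F G D : K⟦X⟧} (hF : d⁄dX K F = F * D) (hG : d⁄dX K G = G * D)
    (h0 : constantCoeff F = constantCoeff G) : F = G := by
  have hH : d⁄dX K (F - G) = (F - G) * D := by rw [map_sub, hF, hG, sub_mul]
  rw [← sub_eq_zero]
  ext n
  induction n using Nat.strong_induction_on with
  | _ n ih =>
    cases n with
    | zero => simp [h0]
    | succ n =>
      have h := congrArg (coeff n) hH
      rw [coeff_derivative, coeff_mul, Finset.sum_eq_zero] at h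
      · have hn : (n : K) + 1 ≠ 0 := by exact_mod_cast n.succ_ne_zero
        simpa [hn] using h
      · intro x hx
        have hx' := Finset.HasAntidiagonal.mem_antidiagonal.mp hx
        rw [ih x.1 (by omega)]
        simp

/-- The exponential of a power series with zero constant term. -/
def expOf (L : K⟦X⟧) : K⟦X⟧ := (exp K).subst L

variable {L M : K⟦X⟧}

theorem derivative_expOf (hL : constantCoeff L = 0) : d⁄dX K (expOf L) = expOf L * d⁄dX K L := by
  rw [expOf, derivative_subst (HasSubst.of_constantCoeff_zero' hL), derivative_exp]

theorem coeff_pow_of_lt (hL : constantCoeff L = 0) {n k : ℕ} (h : n < k) :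
    coeff n (L ^ k) = 0 := by
  obtain ⟨M, rfl⟩ := X_dvd_iff.mpr hL
  rw [mul_pow, coeff_X_pow_mul', if_neg (by omega)]

theorem coeff_expOf (hL : constantCoeff L = 0) {n N : ℕ} (h : n < N) :
    coeff n (expOf L) = ∑ k ∈ Finset.range N, (k.factorial : K)⁻¹ * coeff n (L ^ k) := by
  rw [expOf, coeff_subst' (HasSubst.of_constantCoeff_zero' hL),
    finsum_eq_sum_of_support_subset (s := Finset.range N)]
  · simp
  · intro k hk
    by_contra hkN
    apply hk
    have hkn : n < k := by simp at hkN; omega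
    simp [coeff_pow_of_lt hL hkn]

theorem constantCoeff_expOf (hL : constantCoeff L = 0) : constantCoeff (expOf L) = 1 := by
  rw [← coeff_zero_eq_constantCoeff_apply, coeff_expOf hL zero_lt_one]
  simp

theorem expOf_add (hL : constantCoeff L = 0) (hM : constantCoeff M = 0) :
    expOf (L + M) = expOf L * expOf M := by
  have hLM : constantCoeff (L + M) = 0 := by simp [hL, hM]
  refine eq_of_derivative_eq_mul (derivative_expOf hLM) ?_ ?_
  · rw [Derivation.leibniz, derivative_expOf hL, derivative_expOf hM, map_add]
    simp only [smul_eq_mul]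
    ring
  · simp [constantCoeff_expOf, hL, hM]

theorem rescale_expOf (hL : constantCoeff L = 0) (c : K) :
    rescale c (expOf L) = expOf (rescale c L) := by
  simp only [expOf, rescale_eq_subst]
  rw [subst_comp_subst_apply (HasSubst.of_constantCoeff_zero' hL) (HasSubst.smul_X' c)]

/-- The exponent `Σ_{j≥1} (-1)^{j+1} / (j (w^j - w^{-j})) X^j` of the quantum dilogarithm. -/
def logDilog (w : K) : K⟦X⟧ :=
  mk fun j => (-1 : K) ^ (j + 1) / ((j : K) * (w ^ j - w⁻¹ ^ j))

/-- The quantum dilogarithm as a power series in one variable. -/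
def dilog (w : K) : K⟦X⟧ := expOf (logDilog w)

theorem constantCoeff_logDilog (w : K) : constantCoeff (logDilog w) = 0 := by
  rw [← coeff_zero_eq_constantCoeff_apply, logDilog, coeff_mk]
  simp

theorem constantCoeff_rescale_logDilog (w c : K) :
    constantCoeff (rescale c (logDilog w)) = 0 := by
  rw [← coeff_zero_eq_constantCoeff_apply, coeff_rescale, coeff_zero_eq_constantCoeff_apply,
    constantCoeff_logDilog, mul_zero]

theorem constantCoeff_dilog (w : K) : constantCoeff (dilog w) = 1 :=
  constantCoeff_expOf (constantCoeff_logDilog w)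

theorem rescale_dilog (w c : K) : rescale c (dilog w) = expOf (rescale c (logDilog w)) :=
  rescale_expOf (constantCoeff_logDilog w) c

/-- The `q`-difference equation of the quantum dilogarithm. -/
theorem rescale_dilog_eq_mul {w : K} (hw : ∀ j : ℕ, 0 < j → w ^ j ≠ w⁻¹ ^ j) :
    rescale w (dilog w) = rescale w⁻¹ (dilog w) * (1 + X) := by
  have hgeom : (mk fun n => (-1 : K) ^ n) * (1 + X) = 1 := by
    ext n
    rw [mul_add, mul_one, map_add]
    cases n with
    | zero => simp
    | succ n => simp [coeff_succ_mul_X, coeff_one, pow_succ]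
  have hD : d⁄dX K (rescale w (logDilog w)) =
      d⁄dX K (rescale w⁻¹ (logDilog w)) + mk fun n => (-1 : K) ^ n := by
    ext n
    have hn : (n : K) + 1 ≠ 0 := by exact_mod_cast n.succ_ne_zero
    have hs := sub_ne_zero.mpr (hw (n + 1) n.succ_pos)
    simp only [map_add, coeff_derivative, coeff_rescale, logDilog, coeff_mk, Nat.cast_add,
      Nat.cast_one]
    rw [← sub_eq_iff_eq_add', ← sub_mul, ← sub_mul, pow_add (-1 : K) (n + 1) 1, pow_add (-1 : K) n 1]
    generalize w ^ (n + 1) - w⁻¹ ^ (n + 1) = s at hs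
    field_simp
  rw [rescale_dilog, rescale_dilog]
  have h₁ := constantCoeff_rescale_logDilog w w
  have h₂ := constantCoeff_rescale_logDilog w w⁻¹
  refine eq_of_derivative_eq_mul (derivative_expOf h₁) ?_ ?_
  · rw [Derivation.leibniz, derivative_expOf h₂, hD, map_add, derivative_X, derivative_one]
    simp only [smul_eq_mul]
    linear_combination -(expOf (rescale w⁻¹ (logDilog w))) * hgeom
  · simp [constantCoeff_expOf, h₁, h₂]

theorem dilog_eq_mul {w : K} (hw : ∀ j : ℕ, 0 < j → (w ^ 2) ^ j ≠ (w ^ 2)⁻¹ ^ j) :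
    dilog w = rescale w (dilog (w ^ 2)) * rescale w⁻¹ (dilog (w ^ 2)) := by
  rw [rescale_dilog, rescale_dilog, ← expOf_add (constantCoeff_rescale_logDilog _ _)
    (constantCoeff_rescale_logDilog _ _), dilog]
  congr 1
  ext n
  simp only [map_add, coeff_rescale, logDilog, coeff_mk]
  rcases Nat.eq_zero_or_pos n with rfl | hn
  · simp
  have h := sub_ne_zero.mpr (hw n hn)
  have e : (w ^ 2) ^ n - (w ^ 2)⁻¹ ^ n = (w ^ n - w⁻¹ ^ n) * (w ^ n + w⁻¹ ^ n) := by
    rw [inv_pow w 2 |>.symm]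
    ring
  rw [e] at h ⊢
  have h₁ := left_ne_zero_of_mul h
  have h₂ := right_ne_zero_of_mul h
  have hn' : (n : K) ≠ 0 := by exact_mod_cast hn.ne'
  generalize w ^ n = a at *
  generalize w⁻¹ ^ n = b at *
  field_simp

end PowerSeries

/-- The completed quantum plane `A_γ`, as a type carrying its twisted ring structure. -/
def QPlane (_γ : ℕ) : Type := ℕ × ℕ → K

namespace QPlane

variable {γ : ℕ}

instance : AddCommGroup (QPlane γ) := inferInstanceAs (AddCommGroup (ℕ × ℕ → K))

instance : Module K (QPlane γ) := inferInstanceAs (Module K (ℕ × ℕ → K))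

instance : Mul (QPlane γ) := ⟨qmul γ⟩

instance : One (QPlane γ) := ⟨qone⟩

@[ext]
theorem ext {F G : QPlane γ} (h : ∀ p, F p = G p) : F = G := funext h

@[simp]
theorem add_apply (F G : QPlane γ) (p : ℕ × ℕ) : (F + G) p = F p + G p := rfl

@[simp]
theorem sub_apply (F G : QPlane γ) (p : ℕ × ℕ) : (F - G) p = F p - G p := rfl

@[simp]
theorem zero_apply (p : ℕ × ℕ) : (0 : QPlane γ) p = 0 := rfl

@[simp]
theorem smul_apply (c : K) (F : QPlane γ) (p : ℕ × ℕ) : (c • F) p = c * F p := rfl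

@[simp]
theorem sum_apply {ι : Type*} (s : Finset ι) (F : ι → QPlane γ) (p : ℕ × ℕ) :
    (∑ i ∈ s, F i) p = ∑ i ∈ s, F i p :=
  Finset.sum_apply p s (fun i => (F i : ℕ × ℕ → K))

theorem one_apply (p : ℕ × ℕ) : (1 : QPlane γ) p = if p = (0, 0) then 1 else 0 := rfl

open Finset.HasAntidiagonal in
theorem mul_apply (F G : QPlane γ) (p : ℕ × ℕ) : (F * G) p =
    ∑ z ∈ antidiagonal p.1 ×ˢ antidiagonal p.2,
      v ^ (2 * γ * z.2.1 * z.1.2) * F (z.1.1, z.2.1) * G (z.1.2, z.2.2) := by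
  refine Eq.trans (?_ : _ = ∑ a ∈ Finset.range (p.1 + 1), ∑ b ∈ Finset.range (p.2 + 1),
    v ^ (2 * γ * b * (p.1 - a)) * F (a, b) * G (p.1 - a, p.2 - b)) ?_
  · rfl
  rw [Finset.sum_product, Finset.Nat.sum_antidiagonal_eq_sum_range_succ_mk]
  refine Finset.sum_congr rfl fun a _ => ?_
  rw [Finset.Nat.sum_antidiagonal_eq_sum_range_succ_mk]

open Finset.HasAntidiagonal in
protected theorem mul_assoc (F G H : QPlane γ) : F * G * H = F * (G * H) := by
  ext p
  simp only [mul_apply, Finset.sum_mul, Finset.mul_sum, Finset.sum_sigma']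
  refine Finset.sum_nbij'
    (fun z => ⟨((z.2.1.1, z.2.1.2 + z.1.1.2), (z.2.2.1, z.2.2.2 + z.1.2.2)),
      ((z.2.1.2, z.1.1.2), (z.2.2.2, z.1.2.2))⟩)
    (fun z => ⟨((z.1.1.1 + z.2.1.1, z.2.1.2), (z.1.2.1 + z.2.2.1, z.2.2.2)),
      ((z.1.1.1, z.2.1.1), (z.1.2.1, z.2.2.1))⟩) ?_ ?_ ?_ ?_ ?_
  · rintro ⟨⟨⟨a, b⟩, c, d⟩, ⟨e, g⟩, h, k⟩ hz
    simp only [Finset.mem_sigma, Finset.mem_product, mem_antidiagonal, and_true] at hz ⊢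
    omega
  · rintro ⟨⟨⟨a, b⟩, c, d⟩, ⟨e, g⟩, h, k⟩ hz
    simp only [Finset.mem_sigma, Finset.mem_product, mem_antidiagonal, and_true] at hz ⊢
    omega
  · rintro ⟨⟨⟨a, b⟩, c, d⟩, ⟨e, g⟩, h, k⟩ hz
    simp only [Finset.mem_sigma, Finset.mem_product, mem_antidiagonal] at hz
    obtain ⟨-, rfl, rfl⟩ := hz
    rfl
  · rintro ⟨⟨⟨a, b⟩, c, d⟩, ⟨e, g⟩, h, k⟩ hz
    simp only [Finset.mem_sigma, Finset.mem_product, mem_antidiagonal] at hz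
    obtain ⟨-, rfl, rfl⟩ := hz
    rfl
  · rintro ⟨⟨⟨a, b⟩, c, d⟩, ⟨e, g⟩, h, k⟩ hz
    simp only [Finset.mem_sigma, Finset.mem_product, mem_antidiagonal] at hz
    obtain ⟨-, rfl, rfl⟩ := hz
    simp only
    ring

instance : Ring (QPlane γ) where
  __ := (inferInstance : AddCommGroup (QPlane γ))
  left_distrib F G H := by
    ext p
    simp only [mul_apply, add_apply, ← Finset.sum_add_distrib, mul_add]
  right_distrib F G H := by
    ext p
    simp only [mul_apply, add_apply, ← Finset.sum_add_distrib, mul_add, add_mul]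
  zero_mul F := by
    ext p
    simp [mul_apply]
  mul_zero F := by
    ext p
    simp [mul_apply]
  mul_assoc := QPlane.mul_assoc
  one_mul F := by
    ext p
    rw [mul_apply, Finset.sum_eq_single ((0, p.1), (0, p.2))]
    · simp [one_apply]
    · rintro ⟨⟨a, b⟩, c, d⟩ hz hne
      simp only [Finset.mem_product, Finset.HasAntidiagonal.mem_antidiagonal] at hz
      obtain ⟨h₁, h₂⟩ := hz
      rw [one_apply, if_neg, mul_zero, zero_mul]
      rintro ⟨⟩
      simp_all
    · simp
  mul_one F := by
    ext p
    rw [mul_apply, Finset.sum_eq_single ((p.1, 0), (p.2, 0))]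
    · simp [one_apply]
    · rintro ⟨⟨a, b⟩, c, d⟩ hz hne
      simp only [Finset.mem_product, Finset.HasAntidiagonal.mem_antidiagonal] at hz
      obtain ⟨h₁, h₂⟩ := hz
      rw [one_apply, if_neg, mul_zero]
      rintro ⟨⟩
      simp_all
    · simp

instance : Algebra K (QPlane γ) := Algebra.ofModule
  (fun c F G => by
    ext p
    simp only [mul_apply, smul_apply, Finset.mul_sum]
    exact Finset.sum_congr rfl fun _ _ => by ring)
  (fun c F G => by
    ext p
    simp only [mul_apply, smul_apply, Finset.mul_sum]
    exact Finset.sum_congr rfl fun _ _ => by ring)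

/-- The coefficients of a product in total degree at most `N` only depend on the coefficients of
the factors in total degree at most `N`. -/
theorem mul_apply_congr {F F' G G' : QPlane γ} {p : ℕ × ℕ}
    (hF : ∀ r, r.1 + r.2 ≤ p.1 + p.2 → F r = F' r)
    (hG : ∀ r, r.1 + r.2 ≤ p.1 + p.2 → G r = G' r) : (F * G) p = (F' * G') p := by
  rw [mul_apply, mul_apply]
  refine Finset.sum_congr rfl fun z hz => ?_
  simp only [Finset.mem_product, Finset.HasAntidiagonal.mem_antidiagonal] at hz
  rw [hF _ (by simp only; omega), hG _ (by simp only; omega)]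

theorem mul_apply_eq_zero {F G : QPlane γ} {m n : ℕ} (hF : ∀ r, r.1 + r.2 < m → F r = 0)
    (hG : ∀ r, r.1 + r.2 < n → G r = 0) {p : ℕ × ℕ} (hp : p.1 + p.2 < m + n) :
    (F * G) p = 0 := by
  rw [mul_apply]
  refine Finset.sum_eq_zero fun z hz => ?_
  simp only [Finset.mem_product, Finset.HasAntidiagonal.mem_antidiagonal] at hz
  rcases lt_or_ge (z.1.1 + z.2.1) m with h | h
  · rw [hF _ h, mul_zero, zero_mul]
  · rw [hG (z.1.2, z.2.2) (by simp only; omega), mul_zero]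

variable {U : QPlane γ}

theorem apply_eq_zero_of_lt_one (hU : U (0, 0) = 0) (r : ℕ × ℕ) (hr : r.1 + r.2 < 1) :
    U r = 0 := by
  obtain ⟨a, b⟩ := r
  obtain ⟨rfl, rfl⟩ : a = 0 ∧ b = 0 := by simp only at hr; omega
  exact hU

theorem pow_apply_eq_zero (hU : U (0, 0) = 0) (k : ℕ) (p : ℕ × ℕ) (hp : p.1 + p.2 < k) :
    (U ^ k) p = 0 := by
  induction k generalizing p with
  | zero => omega
  | succ k ih =>
    rw [pow_succ]
    exact mul_apply_eq_zero ih (apply_eq_zero_of_lt_one hU) hp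

/-- Substitution of an element with zero constant term into a power series in one variable. -/
def ev (U : QPlane γ) (g : PowerSeries K) : QPlane γ := fun p =>
  ∑ k ∈ Finset.range (p.1 + p.2 + 1), PowerSeries.coeff k g * (U ^ k) p

theorem ev_apply (hU : U (0, 0) = 0) (g : PowerSeries K) {p : ℕ × ℕ} {N : ℕ}
    (hN : p.1 + p.2 < N) :
    ev U g p = ∑ k ∈ Finset.range N, PowerSeries.coeff k g * (U ^ k) p := by
  refine Finset.sum_subset (Finset.range_mono (by omega)) fun k _ hk => ?_
  rw [pow_apply_eq_zero hU k p (by rw [Finset.mem_range] at hk; omega), mul_zero]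

theorem ev_apply_eq_sum_smul (hU : U (0, 0) = 0) (g : PowerSeries K) {p : ℕ × ℕ} {N : ℕ}
    (hN : p.1 + p.2 < N) :
    ev U g p = (∑ k ∈ Finset.range N, PowerSeries.coeff k g • U ^ k) p := by
  simp [ev_apply hU g hN]

theorem ev_apply_eq_aeval (hU : U (0, 0) = 0) (g : PowerSeries K) {p : ℕ × ℕ} {N : ℕ}
    (hN : p.1 + p.2 < N) : ev U g p = (Polynomial.aeval U (PowerSeries.trunc N g)) p := by
  rw [ev_apply_eq_sum_smul hU g hN, Polynomial.aeval_def,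
    PowerSeries.eval₂_trunc_eq_sum_range]
  simp only [Algebra.smul_def]

theorem aeval_apply_eq_zero (hU : U (0, 0) = 0) {q : Polynomial K} {N : ℕ}
    (hq : ∀ d < N, q.coeff d = 0) {p : ℕ × ℕ} (hN : p.1 + p.2 < N) :
    (Polynomial.aeval U q) p = 0 := by
  obtain ⟨r, rfl⟩ := Polynomial.X_pow_dvd_iff.mpr hq
  rw [map_mul, map_pow, Polynomial.aeval_X]
  exact mul_apply_eq_zero (n := 0) (pow_apply_eq_zero hU N) (fun _ h => absurd h (by omega)) hN

theorem ev_mul (hU : U (0, 0) = 0) (g h : PowerSeries K) : ev U (g * h) = ev U g * ev U h := by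
  ext p
  have hN : p.1 + p.2 < p.1 + p.2 + 1 := Nat.lt_succ_self _
  set N := p.1 + p.2 + 1
  rw [mul_apply_congr (p := p) (fun r hr => ev_apply_eq_aeval hU g (N := N) (by omega))
    (fun r hr => ev_apply_eq_aeval hU h (N := N) (by omega)), ← map_mul,
    ev_apply_eq_aeval hU _ hN, ← sub_eq_zero, ← sub_apply, ← map_sub]
  refine aeval_apply_eq_zero hU (N := N) (fun d hd => ?_) hN
  rw [Polynomial.coeff_sub, PowerSeries.coeff_trunc, if_pos hd, sub_eq_zero]
  rw [PowerSeries.coeff_mul_eq_coeff_trunc_mul_trunc _ _ hd]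
  norm_cast

theorem ev_one : ev U 1 = 1 := by
  ext p
  rw [ev, Finset.sum_eq_single 0]
  · simp
  · intro k _ hk
    simp [PowerSeries.coeff_one, hk]
  · simp

theorem ev_X (hU : U (0, 0) = 0) : ev U PowerSeries.X = U := by
  ext p
  rw [ev_apply hU _ (N := p.1 + p.2 + 2) (by omega), Finset.sum_eq_single 1]
  · simp
  · intro k _ hk
    simp [PowerSeries.coeff_X, hk]
  · simp

theorem ev_add (g h : PowerSeries K) : ev U (g + h) = ev U g + ev U h := by
  ext p
  simp [ev, add_mul, Finset.sum_add_distrib]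

theorem ev_pow (hU : U (0, 0) = 0) (g : PowerSeries K) (k : ℕ) : ev U (g ^ k) = ev U g ^ k := by
  induction k with
  | zero => simp [ev_one]
  | succ k ih => rw [pow_succ, pow_succ, ev_mul hU, ih]

theorem ev_smul (c : K) (g : PowerSeries K) : ev (c • U) g = ev U (PowerSeries.rescale c g) := by
  ext p
  simp only [ev, smul_pow, smul_apply, PowerSeries.coeff_rescale]
  exact Finset.sum_congr rfl fun _ _ => by ring

theorem ev_zero (g : PowerSeries K) :
    ev (0 : QPlane γ) g = PowerSeries.constantCoeff g • (1 : QPlane γ) := by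
  ext p
  rw [ev, Finset.sum_eq_single 0]
  · simp
  · intro k _ hk
    simp [hk]
  · simp

theorem ev_mul_of_commute {Z X : QPlane γ} {c : K} (hZ : Z (0, 0) = 0)
    (h : Z * X = c • (X * Z)) (g : PowerSeries K) :
    ev Z g * X = X * ev (c • Z) g := by
  have hpow (k : ℕ) : Z ^ k * X = X * (c • Z) ^ k := by
    have : SemiconjBy X (c • Z) Z := by rw [SemiconjBy, h, mul_smul_comm]
    exact (this.pow_right k).symm
  have hcZ : (c • Z) (0, 0) = 0 := by simp [hZ]
  ext p
  rw [mul_apply_congr (p := p) (fun r hr => ev_apply_eq_sum_smul hZ g (N := p.1 + p.2 + 1)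
    (by omega)) (fun r _ => rfl), mul_apply_congr (p := p) (fun r _ => rfl) (fun r hr =>
    ev_apply_eq_sum_smul hcZ g (N := p.1 + p.2 + 1) (by omega)), Finset.sum_mul, Finset.mul_sum]
  simp only [smul_mul_assoc, mul_smul_comm, hpow]

/-- Multiplication of the coefficients of `Y₁^m Y₂^n` by `c^m`. -/
def scaleFun (c : K) (F : QPlane γ) : QPlane γ := fun p => c ^ p.1 * F p

theorem scaleFun_apply (c : K) (F : QPlane γ) (p : ℕ × ℕ) :
    scaleFun c F p = c ^ p.1 * F p := rfl

/-- The ring endomorphism scaling `Y₁` by `c`. -/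
def scale (c : K) : QPlane γ →+* QPlane γ where
  toFun := scaleFun c
  map_one' := by
    ext p
    rw [scaleFun_apply, one_apply]
    split_ifs with h <;> simp [h]
  map_mul' F G := by
    ext p
    rw [scaleFun_apply, mul_apply, mul_apply, Finset.mul_sum]
    refine Finset.sum_congr rfl fun z hz => ?_
    simp only [Finset.mem_product, Finset.HasAntidiagonal.mem_antidiagonal] at hz
    rw [← hz.1, scaleFun_apply, scaleFun_apply]
    ring
  map_zero' := by
    ext p
    simp [scaleFun_apply]
  map_add' F G := by
    ext p
    simp [scaleFun_apply, mul_add]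

theorem scale_apply (c : K) (F : QPlane γ) (p : ℕ × ℕ) : scale c F p = c ^ p.1 * F p := rfl

theorem scale_ev (c : K) (g : PowerSeries K) : scale c (ev U g) = ev (scale c U) g := by
  ext p
  simp only [scale_apply, ev, ← map_pow, Finset.mul_sum]
  exact Finset.sum_congr rfl fun _ _ => by ring

/-- A solution of a `q`-difference equation is determined by its part of degree `0` in `Y₁`. -/
theorem eq_of_scale_eq_mul {w : K} (hw : ∀ j : ℕ, 0 < j → w ^ j ≠ w⁻¹ ^ j) {X F G : QPlane γ}
    (hX : X (0, 0) = 0) (hF : scale w F = scale w⁻¹ F * (1 + X))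
    (hG : scale w G = scale w⁻¹ G * (1 + X)) (h0 : scale 0 F = scale 0 G) : F = G := by
  have hH : scale w (F - G) = scale w⁻¹ (F - G) + scale w⁻¹ (F - G) * X := by
    rw [map_sub, map_sub, hF, hG]
    noncomm_ring
  have hH0 : scale 0 (F - G) = 0 := by rw [map_sub, h0, sub_self]
  rw [← sub_eq_zero]
  generalize F - G = H at *
  have key (N : ℕ) : ∀ r : ℕ × ℕ, r.1 + r.2 < N → H r = 0 := by
    induction N with
    | zero => intro r hr; omega
    | succ N ih =>
      intro r hr
      rcases Nat.eq_zero_or_pos r.1 with h | h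
      · simpa [scale_apply, h] using congrFun hH0 r
      · have e := congrFun hH r
        rw [add_apply, mul_apply_eq_zero (m := N) (n := 1) _ (apply_eq_zero_of_lt_one hX) hr,
          scale_apply, scale_apply, add_zero] at e
        · by_contra hr0
          exact hw _ h (mul_right_cancel₀ hr0 e)
        · intro r hr
          rw [scale_apply, ih r hr, mul_zero]
  ext r
  exact key _ r (Nat.lt_succ_self _)

/-- The quantum dilogarithm of an element with zero constant term. -/
def psi (w : K) (U : QPlane γ) : QPlane γ := ev U (PowerSeries.dilog w)

theorem qpow_eq_pow (Z : QPlane γ) (k : ℕ) : (qpow γ Z k : QPlane γ) = Z ^ k := by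
  induction k with
  | zero => rfl
  | succ k ih =>
    rw [pow_succ', ← ih]
    rfl

theorem qarg_eq_ev (w : K) (Z : QPlane γ) :
    (qarg γ w Z : QPlane γ) = ev Z (PowerSeries.logDilog w) := by
  ext p
  change ∑ j ∈ Finset.Icc 1 (p.1 + p.2), _ * (qpow γ Z j : QPlane γ) p = _
  refine Finset.sum_subset_zero_on_sdiff ?_ ?_ ?_
  · intro k hk
    simp only [Finset.mem_Icc, Finset.mem_range] at hk ⊢
    omega
  · intro k hk
    obtain rfl : k = 0 := by
      simp only [Finset.mem_sdiff, Finset.mem_Icc, Finset.mem_range] at hk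
      omega
    simp [PowerSeries.constantCoeff_logDilog]
  · intro k _
    rw [qpow_eq_pow, PowerSeries.logDilog, PowerSeries.coeff_mk]

theorem qPsi_eq_psi (w : K) {Z : QPlane γ} (hZ : Z (0, 0) = 0) :
    (qPsi γ w Z : QPlane γ) = psi w Z := by
  ext p
  have hpow (k : ℕ) : (qpow γ (qarg γ w Z) k : QPlane γ) = ev Z (PowerSeries.logDilog w ^ k) := by
    rw [ev_pow hZ, ← qpow_eq_pow]
    exact congrArg (qpow γ · k) (qarg_eq_ev w Z)
  refine Eq.trans (Finset.sum_congr rfl fun k _ =>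
    congrArg ((Nat.factorial k : K)⁻¹ * ·) (congrFun (hpow k) p)) ?_
  have hL := PowerSeries.constantCoeff_logDilog w
  rw [psi, PowerSeries.dilog, ev]
  simp_rw [ev, Finset.mul_sum]
  rw [Finset.sum_comm]
  refine Finset.sum_congr rfl fun m hm => ?_
  rw [PowerSeries.coeff_expOf hL (Finset.mem_range.mp hm), Finset.sum_mul]
  exact Finset.sum_congr rfl fun _ _ => by ring

theorem psi_smul_eq_mul {w : K} (hw : ∀ j : ℕ, 0 < j → w ^ j ≠ w⁻¹ ^ j) (hU : U (0, 0) = 0) :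
    psi w (w • U) = psi w (w⁻¹ • U) * (1 + U) := by
  rw [psi, psi, ev_smul, ev_smul, PowerSeries.rescale_dilog_eq_mul hw, ev_mul hU, ev_add, ev_one,
    ev_X hU]

theorem psi_smul_eq_mul' {w : K} (hw : ∀ j : ℕ, 0 < j → w ^ j ≠ w⁻¹ ^ j) (hU : U (0, 0) = 0) :
    psi w (w • U) = (1 + U) * psi w (w⁻¹ • U) := by
  rw [psi, psi, ev_smul, ev_smul, PowerSeries.rescale_dilog_eq_mul hw, mul_comm, ev_mul hU, ev_add,
    ev_one, ev_X hU]

theorem psi_mul_of_commute (w : K) {Z X : QPlane γ} {c : K} (hZ : Z (0, 0) = 0)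
    (h : Z * X = c • (X * Z)) : psi w Z * X = X * psi w (c • Z) :=
  ev_mul_of_commute hZ h _

theorem scale_psi (c w : K) (U : QPlane γ) : scale c (psi w U) = psi w (scale c U) :=
  scale_ev c _

theorem psi_zero (w : K) : psi w (0 : QPlane γ) = 1 := by
  rw [psi, ev_zero, PowerSeries.constantCoeff_dilog, one_smul]

theorem psi_eq_mul {w : K} (hw : ∀ j : ℕ, 0 < j → (w ^ 2) ^ j ≠ (w ^ 2)⁻¹ ^ j)
    (hU : U (0, 0) = 0) : psi w U = psi (w ^ 2) (w • U) * psi (w ^ 2) (w⁻¹ • U) := by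
  rw [psi, psi, psi, ev_smul, ev_smul, PowerSeries.dilog_eq_mul hw, ev_mul hU]

theorem psi_eq_mul' {w : K} (hw : ∀ j : ℕ, 0 < j → (w ^ 2) ^ j ≠ (w ^ 2)⁻¹ ^ j)
    (hU : U (0, 0) = 0) : psi w U = psi (w ^ 2) (w⁻¹ • U) * psi (w ^ 2) (w • U) := by
  rw [psi, psi, psi, ev_smul, ev_smul, PowerSeries.dilog_eq_mul hw, mul_comm, ev_mul hU]

/-- The `B₂`-type dilogarithm identity for `w⁴`-commuting elements. -/
theorem psi_mul_psi {w : K} (hw0 : w ≠ 0) (hw : ∀ j : ℕ, 0 < j → w ^ j ≠ w⁻¹ ^ j)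
    {X Y V Z : QPlane γ} (hX : X (0, 0) = 0) (hY : Y (0, 0) = 0) (hV : V (0, 0) = 0)
    (hZ : Z (0, 0) = 0) (hZX : Z * X = w ^ 4 • (X * Z)) (hYX : Y * X = w ^ 4 • (X * Y))
    (hVX : V * X = w ^ 4 • (X * V)) (hXZ : w ^ 2 • (X * Z) = Y) (hXY : w ^ 2 • (X * Y) = V)
    (sX : ∀ c, scale c X = c • X) (sY : ∀ c, scale c Y = c • Y)
    (sV : ∀ c, scale c V = c ^ 2 • V) (sZ : ∀ c, scale c Z = Z) :
    psi (w ^ 2) Z * psi w X = psi w X * psi (w ^ 2) V * psi w Y * psi (w ^ 2) Z := by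
  have hw2 : ∀ j : ℕ, 0 < j → (w ^ 2) ^ j ≠ (w ^ 2)⁻¹ ^ j := fun j hj => by
    rw [← inv_pow, ← pow_mul, ← pow_mul]
    exact hw _ (by omega)
  have cZ : psi (w ^ 2) Z * X = (X + Y) * psi (w ^ 2) Z := by
    have h := psi_smul_eq_mul' hw2 (U := w ^ 2 • Z) (by simp [hZ])
    rw [smul_smul, smul_smul, inv_mul_cancel₀ (pow_ne_zero 2 hw0), one_smul, ← pow_add] at h
    rw [psi_mul_of_commute _ hZ hZX, h, ← mul_assoc, mul_add, mul_one, mul_smul_comm, hXZ]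
  have cY : psi w (w⁻¹ • Y) * X = (X + V) * psi w (w • Y) := by
    have h := psi_smul_eq_mul' hw (U := w ^ 2 • Y) (by simp [hY])
    rw [smul_smul, smul_smul] at h
    rw [psi_mul_of_commute (c := w ^ 4) _ (by simp [hY]) (by
        rw [smul_mul_assoc, hYX, mul_smul_comm, smul_comm]), smul_smul,
      show w ^ 4 * w⁻¹ = w * w ^ 2 by field_simp, h, ← mul_assoc, mul_add, mul_one, mul_smul_comm,
      hXY, show w⁻¹ * w ^ 2 = w by field_simp]
  have cV : psi (w ^ 2) ((w ^ 2)⁻¹ • V) * X = X * psi (w ^ 2) (w ^ 2 • V) := by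
    rw [psi_mul_of_commute (c := w ^ 4) _ (by simp [hV]) (by
        rw [smul_mul_assoc, hVX, mul_smul_comm, smul_comm]), smul_smul,
      show w ^ 4 * (w ^ 2)⁻¹ = w ^ 2 by field_simp]
  refine eq_of_scale_eq_mul hw hX ?_ ?_ ?_
  · simp only [map_mul, scale_psi, sX, sZ]
    rw [psi_smul_eq_mul hw hX, mul_assoc]
  · simp only [map_mul, scale_psi, sX, sY, sV, sZ]
    have eX := psi_smul_eq_mul hw hX
    have eY := psi_smul_eq_mul hw hY
    have eV := psi_smul_eq_mul hw2 hV
    rw [inv_pow]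
    rw [eX]
    have key : (1 + X) * (psi (w ^ 2) (w ^ 2 • V) * (psi w (w • Y) * psi (w ^ 2) Z)) =
        psi (w ^ 2) ((w ^ 2)⁻¹ • V) * (psi w (w⁻¹ • Y) * (psi (w ^ 2) Z * (1 + X))) := by
      symm
      calc psi (w ^ 2) ((w ^ 2)⁻¹ • V) * (psi w (w⁻¹ • Y) * (psi (w ^ 2) Z * (1 + X)))
          = psi (w ^ 2) ((w ^ 2)⁻¹ • V) *
              (psi w (w⁻¹ • Y) * (1 + Y) + psi w (w⁻¹ • Y) * X) * psi (w ^ 2) Z := by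
            rw [mul_add (psi (w ^ 2) Z), cZ]
            noncomm_ring
        _ = (psi (w ^ 2) ((w ^ 2)⁻¹ • V) * (1 + V) + psi (w ^ 2) ((w ^ 2)⁻¹ • V) * X) *
              psi w (w • Y) * psi (w ^ 2) Z := by
            rw [← eY, cY]
            noncomm_ring
        _ = _ := by
            rw [← eV, cV]
            noncomm_ring
    simp only [mul_assoc] at key ⊢
    rw [key]
  · simp only [map_mul, scale_psi, sX, sY, sV, sZ]
    simp [psi_zero]

/-- The element `v^β · y^{(m,n)}` of the quantum plane. -/
def mono (β : ℤ) (m n : ℕ) : QPlane γ := qy γ β m n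

theorem mono_apply (β : ℤ) (m n : ℕ) (p : ℕ × ℕ) : (mono β m n : QPlane γ) p =
    if p = (m, n) then v ^ (β + (γ : ℤ) * (m : ℤ) * (n : ℤ)) else 0 := rfl

theorem v_ne_zero : v ≠ 0 := RatFunc.X_ne_zero

theorem mono_apply_zero (β : ℤ) {m n : ℕ} (h : 0 < m + n) :
    (mono β m n : QPlane γ) (0, 0) = 0 := by
  rw [mono_apply, if_neg]
  rintro ⟨⟩
  omega

theorem mono_mul_mono (a b : ℤ) (m n m' n' : ℕ) :
    (mono a m n * mono b m' n' : QPlane γ) =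
      mono (a + b + γ * (n * m' - m * n')) (m + m') (n + n') := by
  ext p
  rw [mul_apply, mono_apply]
  split_ifs with h
  · subst h
    rw [Finset.sum_eq_single ((m, m'), (n, n'))]
    · simp only [mono_apply, if_true]
      rw [← zpow_natCast, ← zpow_add₀ v_ne_zero, ← zpow_add₀ v_ne_zero]
      congr 1
      push_cast
      ring
    · rintro ⟨⟨a, b⟩, c, d⟩ hz hne
      rw [mono_apply, mono_apply]
      split_ifs with h₁ h₂
      · cases h₁
        cases h₂
        exact absurd rfl hne
      all_goals simp
    · intro hz
      simp at hz
  · refine Finset.sum_eq_zero fun z hz => ?_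
    simp only [Finset.mem_product, Finset.HasAntidiagonal.mem_antidiagonal] at hz
    rw [mono_apply, mono_apply]
    split_ifs with h₁ h₂
    · exfalso
      apply h
      rw [Prod.mk.injEq] at h₁ h₂
      rw [← h₁.1, ← h₁.2, ← h₂.1, ← h₂.2, hz.1, hz.2]
    all_goals simp

theorem zpow_smul_mono (s β : ℤ) (m n : ℕ) :
    v ^ s • (mono β m n : QPlane γ) = mono (s + β) m n := by
  ext p
  rw [smul_apply, mono_apply, mono_apply]
  split_ifs
  · rw [← zpow_add₀ v_ne_zero, add_assoc]
  · rw [mul_zero]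

theorem pow_smul_mono (s : ℕ) (β : ℤ) (m n : ℕ) :
    v ^ s • (mono β m n : QPlane γ) = mono (s + β) m n := by
  rw [← zpow_natCast, zpow_smul_mono]

theorem scale_mono (c : K) (β : ℤ) (m n : ℕ) :
    scale c (mono β m n : QPlane γ) = c ^ m • mono β m n := by
  ext p
  rw [smul_apply, scale_apply, mono_apply]
  split_ifs with h
  · rw [h]
  · simp

theorem v_pow_ne_inv {k : ℕ} (hk : 0 < k) (j : ℕ) (hj : 0 < j) : (v ^ k) ^ j ≠ (v ^ k)⁻¹ ^ j := by
  intro h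
  rw [← inv_pow, ← pow_mul, ← pow_mul, inv_pow, ← mul_eq_one_iff_eq_inv₀
    (pow_ne_zero _ v_ne_zero), ← pow_add, v, ← RatFunc.algebraMap_X, ← map_pow,
    ← map_one (algebraMap (Polynomial ℚ) (RatFunc ℚ))] at h
  have h' := congrArg Polynomial.natDegree (RatFunc.algebraMap_injective ℚ h)
  rw [Polynomial.natDegree_X_pow, Polynomial.natDegree_one] at h'
  have := Nat.mul_pos hk hj
  omega

variable {f : ℕ}

theorem psi_mono_mul_psi_mono (hf : 0 < f) (β β' : ℤ) (p : ℕ) :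
    (psi (v ^ (4 * f)) (mono β' 0 1) * psi (v ^ (2 * f)) (mono β 1 p) : QPlane (4 * f)) =
      psi (v ^ (2 * f)) (mono β 1 p) *
        psi (v ^ (4 * f)) (mono (2 * β + β') 2 (2 * p + 1)) *
        psi (v ^ (2 * f)) (mono (β + β') 1 (p + 1)) * psi (v ^ (4 * f)) (mono β' 0 1) := by
  have e : v ^ (4 * f) = (v ^ (2 * f)) ^ 2 := by rw [← pow_mul]; ring
  rw [e]
  apply psi_mul_psi (pow_ne_zero _ v_ne_zero) (v_pow_ne_inv (by omega))
  any_goals exact mono_apply_zero _ (by omega)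
  any_goals
    simp only [← pow_mul, mono_mul_mono, pow_smul_mono]
    congr 1 <;> push_cast <;> ring
  all_goals
    intro c
    simp [scale_mono]

theorem psi_mono_mul_self (hf : 0 < f) {ε : ℤ} (hε : ε = 1 ∨ ε = -1) (b : ℤ) {m n : ℕ}
    (h : 0 < m + n) :
    (psi (v ^ (2 * f)) (mono (b - ε * f) m n) * psi (v ^ (2 * f)) (mono (b + ε * f) m n) :
      QPlane γ) = psi (v ^ f) (mono b m n) := by
  have e : v ^ (2 * f) = (v ^ f) ^ 2 := by rw [← pow_mul, mul_comm]
  have h2 : ∀ j : ℕ, 0 < j → ((v ^ f) ^ 2) ^ j ≠ ((v ^ f) ^ 2)⁻¹ ^ j := by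
    rw [← e]
    exact v_pow_ne_inv (by omega)
  have hm := mono_apply_zero (γ := γ) b h
  have e₁ : (mono (b - f) m n : QPlane γ) = (v ^ f)⁻¹ • mono b m n := by
    rw [← zpow_natCast, ← zpow_neg, zpow_smul_mono]
    congr 1
    ring
  have e₂ : (mono (b + f) m n : QPlane γ) = v ^ f • mono b m n := by
    rw [pow_smul_mono, add_comm]
  rw [e]
  rcases hε with rfl | rfl
  · rw [one_mul, e₁, e₂, psi_eq_mul' h2 hm]
  · rw [neg_one_mul, sub_neg_eq_add, ← sub_eq_add_neg, e₁, e₂, psi_eq_mul h2 hm]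

theorem qPsi_qy (w : K) {β β' : ℤ} (hβ : β = β') {m n : ℕ} (h : 0 < m + n) :
    (qPsi γ w (qy γ β m n) : QPlane γ) = psi w (mono β' m n : QPlane γ) := by
  subst hβ
  exact qPsi_eq_psi w (mono_apply_zero β h)

theorem qmul_eq_mul {F G : QP} {F' G' : QPlane γ} (hF : F = F') (hG : G = G') :
    qmul γ F G = (F' * G' : QPlane γ) := by
  subst hF hG
  rfl

/-- The ordered product `g_a g_{a+1} ⋯ g_b`. -/
def prodR (g : ℕ → QPlane γ) (a b : ℕ) : QPlane γ :=
  ((List.range' a (b + 1 - a)).map g).prod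

/-- The ordered product `g_b ⋯ g_{a+1} g_a`. -/
def prodL (g : ℕ → QPlane γ) (a b : ℕ) : QPlane γ :=
  ((List.range' a (b + 1 - a)).reverse.map g).prod

theorem qprodR_eq_prodR {g : ℕ → QP} {h : ℕ → QPlane γ} (H : ∀ p, g p = h p) (a b : ℕ) :
    qprodR γ g a b = prodR h a b := by
  obtain rfl : g = h := funext H
  rfl

theorem qprodL_eq_prodL {g : ℕ → QP} {h : ℕ → QPlane γ} (H : ∀ p, g p = h p) (a b : ℕ) :
    qprodL γ g a b = prodL h a b := by
  obtain rfl : g = h := funext H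
  rfl

theorem prodR_succ (g : ℕ → QPlane γ) {a b : ℕ} (h : a ≤ b + 1) :
    prodR g a (b + 1) = prodR g a b * g (b + 1) := by
  rw [prodR, prodR, Nat.sub_add_comm h, List.range'_1_concat, Nat.add_sub_cancel' h]
  simp

/-- The anti-automorphism exchanging `Y₁` and `Y₂`. -/
def swap (F : QPlane γ) : QPlane γ := fun p => F p.swap

theorem swap_apply (F : QPlane γ) (p : ℕ × ℕ) : swap F p = F p.swap := rfl

theorem swap_mul (F G : QPlane γ) : swap (F * G) = swap G * swap F := by
  ext p
  rw [swap_apply, mul_apply, mul_apply]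
  refine Finset.sum_nbij' (fun z => (z.2.swap, z.1.swap)) (fun z => (z.2.swap, z.1.swap))
    ?_ ?_ (fun _ _ => rfl) (fun _ _ => rfl) ?_
  · intro z hz
    simp only [Finset.mem_product, Finset.HasAntidiagonal.mem_antidiagonal, Prod.fst_swap,
      Prod.snd_swap] at hz ⊢
    omega
  · intro z hz
    simp only [Finset.mem_product, Finset.HasAntidiagonal.mem_antidiagonal, Prod.fst_swap,
      Prod.snd_swap] at hz ⊢
    omega
  · intro z _
    simp only [swap_apply, Prod.swap_prod_mk, Prod.fst_swap, Prod.snd_swap]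
    ring

theorem swap_one : swap (1 : QPlane γ) = 1 := by
  ext ⟨a, b⟩
  simp [swap_apply, one_apply, and_comm]

theorem swap_pow (F : QPlane γ) (k : ℕ) : swap (F ^ k) = swap F ^ k := by
  induction k with
  | zero => simp [swap_one]
  | succ k ih => rw [pow_succ, swap_mul, ih, pow_succ']

theorem swap_psi (w : K) : swap (psi w U) = psi w (swap U) := by
  ext p
  simp only [psi, swap_apply, ev, ← swap_pow, Prod.fst_swap, Prod.snd_swap, add_comm p.2]

theorem swap_mono (β : ℤ) (m n : ℕ) : swap (mono β m n : QPlane γ) = mono β n m := by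
  ext ⟨a, b⟩
  simp only [swap_apply, mono_apply, Prod.swap_prod_mk, Prod.mk.injEq, and_comm (a := b = m)]
  rw [mul_right_comm]

theorem swap_prodR (g : ℕ → QPlane γ) (a b : ℕ) :
    swap (prodR g a b) = prodL (fun p => swap (g p)) a b := by
  rw [prodR, prodL]
  induction List.range' a (b + 1 - a) with
  | nil => simp [swap_one]
  | cons x l ih => simp [swap_mul, ih]

theorem mul_mul_eq_of_exchange {M : Type*} [Monoid M] {A B C D E P Q R S T : M}
    (h : A * P = T * (Q * (R * (S * A)))) (hAB : A * B = B * (C * (D * A))) (hSB : S * B = E) :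
    A * (P * B) = T * (Q * (R * E) * (C * (D * A))) := by
  rw [← mul_assoc, h, ← hSB]
  simp only [mul_assoc, hAB]

theorem psi_mul_prodR (hf : 0 < f) (β β' : ℤ) {ε : ℤ} (hε : ε = 1 ∨ ε = -1) (ℓ : ℕ) :
    (psi (v ^ (4 * f)) (mono β' 0 1) *
        prodR (fun p => psi (v ^ (2 * f)) (mono (β + p * β' + 2 * p * ε * f) 1 p)) 0 ℓ :
          QPlane (4 * f)) =
      psi (v ^ (2 * f)) (mono β 1 0) *
        (prodR (fun p =>
            psi (v ^ (4 * f))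
              (mono (2 * β + (2 * p - 1) * β' + 4 * (p - 1) * ε * f) 2 (2 * p - 1)) *
            psi (v ^ f) (mono (β + p * β' + (2 * p - 1) * ε * f) 1 p)) 1 ℓ *
          (psi (v ^ (4 * f)) (mono (2 * β + (2 * ℓ + 1) * β' + 4 * ℓ * ε * f) 2 (2 * ℓ + 1)) *
            (psi (v ^ (2 * f)) (mono (β + (ℓ + 1) * β' + 2 * ℓ * ε * f) 1 (ℓ + 1)) *
              psi (v ^ (4 * f)) (mono β' 0 1)))) := by
  induction ℓ with
  | zero =>
    have h := psi_mono_mul_psi_mono hf β β' 0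
    simpa [prodR, mul_assoc] using h
  | succ ℓ ih =>
    rw [prodR_succ _ (by omega), prodR_succ _ (by omega), show 2 * (ℓ + 1) - 1 = 2 * ℓ + 1 by omega,
      show 2 * β + (2 * ((ℓ + 1 : ℕ) : ℤ) - 1) * β' + 4 * (((ℓ + 1 : ℕ) : ℤ) - 1) * ε * f =
        2 * β + (2 * ℓ + 1) * β' + 4 * ℓ * ε * f by push_cast; ring]
    refine mul_mul_eq_of_exchange ih ?_ ?_
    · rw [psi_mono_mul_psi_mono hf, mul_assoc, mul_assoc]
      refine congrArg _ (congrArg₂ (· * ·) ?_ (congrArg₂ (· * ·) ?_ rfl))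
      all_goals
        congr 2
        push_cast
        ring
    · rw [← psi_mono_mul_self hf hε _ (by omega)]
      congr 3
      all_goals
        push_cast
        ring

end QPlane

/-- Lemma A.5, quantum-plane form: in `A_{4f}`, for `ε = ±1` and `ℓ ≥ 0`,
(i) `Ψ_{v^{4f}}(v^{β'}Y₂)·→∏_{p=0..ℓ} Ψ_{v^{2f}}(v^{β+pβ'+2pεf}y^{(1,p)})
  = Ψ_{v^{2f}}(v^{β}Y₁)·
    (→∏_{p=1..ℓ} [Ψ_{v^{4f}}(v^{2β+(2p−1)β'+4(p−1)εf}y^{(2,2p−1)})·Ψ_{v^f}(v^{β+pβ'+(2p−1)εf}y^{(1,p)})])·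
    Ψ_{v^{4f}}(v^{2β+(2ℓ+1)β'+4ℓεf}y^{(2,2ℓ+1)})·Ψ_{v^{2f}}(v^{β+(ℓ+1)β'+2ℓεf}y^{(1,ℓ+1)})·
    Ψ_{v^{4f}}(v^{β'}Y₂)`, and
(ii) `(←∏_{p=0..ℓ} Ψ_{v^{2f}}(v^{pβ+β'+2pεf}y^{(p,1)}))·Ψ_{v^{4f}}(v^{β}Y₁)
  = Ψ_{v^{4f}}(v^{β}Y₁)·Ψ_{v^{2f}}(v^{(ℓ+1)β+β'+2ℓεf}y^{(ℓ+1,1)})·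
    Ψ_{v^{4f}}(v^{(2ℓ+1)β+2β'+4ℓεf}y^{(2ℓ+1,2)})·
    (←∏_{p=1..ℓ} [Ψ_{v^f}(v^{pβ+β'+(2p−1)εf}y^{(p,1)})·Ψ_{v^{4f}}(v^{(2p−1)β+2β'+4(p−1)εf}y^{(2p−1,2)})])·
    Ψ_{v^{2f}}(v^{β'}Y₂)`. -/
theorem lemma_A5 (f : ℕ) (hf : 0 < f) (β β' ε : ℤ) (hε : ε = 1 ∨ ε = -1) (ℓ : ℕ) :
    (qmul (4 * f) (qPsi (4 * f) (v ^ (4 * f)) (qy (4 * f) β' 0 1))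
        (qprodR (4 * f)
          (fun p => qPsi (4 * f) (v ^ (2 * f))
            (qy (4 * f) (β + (p : ℤ) * β' + 2 * (p : ℤ) * ε * (f : ℤ)) 1 p)) 0 ℓ)
      = qmul (4 * f) (qPsi (4 * f) (v ^ (2 * f)) (qy (4 * f) β 1 0))
          (qmul (4 * f)
            (qprodR (4 * f)
              (fun p => qmul (4 * f)
                (qPsi (4 * f) (v ^ (4 * f))
                  (qy (4 * f)
                    (2 * β + (2 * (p : ℤ) - 1) * β' + 4 * ((p : ℤ) - 1) * ε * (f : ℤ)) 2 (2 * p - 1)))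
                (qPsi (4 * f) (v ^ f)
                  (qy (4 * f) (β + (p : ℤ) * β' + (2 * (p : ℤ) - 1) * ε * (f : ℤ)) 1 p))) 1 ℓ)
            (qmul (4 * f)
              (qPsi (4 * f) (v ^ (4 * f))
                (qy (4 * f)
                  (2 * β + (2 * (ℓ : ℤ) + 1) * β' + 4 * (ℓ : ℤ) * ε * (f : ℤ)) 2 (2 * ℓ + 1)))
              (qmul (4 * f)
                (qPsi (4 * f) (v ^ (2 * f))
                  (qy (4 * f)
                    (β + ((ℓ : ℤ) + 1) * β' + 2 * (ℓ : ℤ) * ε * (f : ℤ)) 1 (ℓ + 1)))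
                (qPsi (4 * f) (v ^ (4 * f)) (qy (4 * f) β' 0 1))))))
    ∧
    (qmul (4 * f)
        (qprodL (4 * f)
          (fun p => qPsi (4 * f) (v ^ (2 * f))
            (qy (4 * f) ((p : ℤ) * β + β' + 2 * (p : ℤ) * ε * (f : ℤ)) p 1)) 0 ℓ)
        (qPsi (4 * f) (v ^ (4 * f)) (qy (4 * f) β 1 0))
      = qmul (4 * f) (qPsi (4 * f) (v ^ (4 * f)) (qy (4 * f) β 1 0))
          (qmul (4 * f)
            (qPsi (4 * f) (v ^ (2 * f))
              (qy (4 * f) (((ℓ : ℤ) + 1) * β + β' + 2 * (ℓ : ℤ) * ε * (f : ℤ)) (ℓ + 1) 1))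
            (qmul (4 * f)
              (qPsi (4 * f) (v ^ (4 * f))
                (qy (4 * f)
                  ((2 * (ℓ : ℤ) + 1) * β + 2 * β' + 4 * (ℓ : ℤ) * ε * (f : ℤ)) (2 * ℓ + 1) 2))
              (qmul (4 * f)
                (qprodL (4 * f)
                  (fun p => qmul (4 * f)
                    (qPsi (4 * f) (v ^ f)
                      (qy (4 * f) ((p : ℤ) * β + β' + (2 * (p : ℤ) - 1) * ε * (f : ℤ)) p 1))
                    (qPsi (4 * f) (v ^ (4 * f))
                      (qy (4 * f)
                        ((2 * (p : ℤ) - 1) * β + 2 * β' + 4 * ((p : ℤ) - 1) * ε * (f : ℤ))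
                        (2 * p - 1) 2))) 1 ℓ)
                (qPsi (4 * f) (v ^ (2 * f)) (qy (4 * f) β' 0 1)))))) := by
  have fwd (β β' : ℤ) := QPlane.psi_mul_prodR hf β β' hε ℓ
  open QPlane in
  refine ⟨?_, ?_⟩
  · refine Eq.trans (qmul_eq_mul (qPsi_qy _ rfl (by omega)) (qprodR_eq_prodR (fun p =>
      qPsi_qy _ rfl (by omega)) _ _)) ((fwd β β').trans (Eq.symm ?_))
    refine qmul_eq_mul (qPsi_qy _ rfl (by omega)) (qmul_eq_mul (qprodR_eq_prodR (fun p =>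
      qmul_eq_mul (qPsi_qy _ rfl (by omega)) (qPsi_qy _ rfl (by omega))) _ _)
      (qmul_eq_mul (qPsi_qy _ rfl (by omega)) (qmul_eq_mul (qPsi_qy _ rfl (by omega))
        (qPsi_qy _ rfl (by omega)))))
  · have h := congrArg swap (fwd β' β)
    simp only [swap_mul, swap_prodR, swap_psi, swap_mono] at h
    rw [mul_assoc, mul_assoc, mul_assoc] at h
    refine Eq.trans (qmul_eq_mul (qprodL_eq_prodL (fun p =>
      qPsi_qy _ (by ring) (by omega)) _ _) (qPsi_qy _ rfl (by omega))) (h.trans (Eq.symm ?_))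
    refine qmul_eq_mul (qPsi_qy _ rfl (by omega)) (qmul_eq_mul (qPsi_qy _ (by ring) (by omega))
      (qmul_eq_mul (qPsi_qy _ (by ring) (by omega)) (qmul_eq_mul (qprodL_eq_prodL (fun p =>
        qmul_eq_mul (qPsi_qy _ (by ring) (by omega)) (qPsi_qy _ (by ring) (by omega))) _ _)
        (qPsi_qy _ rfl (by omega)))))
end
end
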